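/- An n-homological pair (Λ, 𝔪) is pure semisimple (Add(𝔪) is an n-cluster tilting subcategory of Mod-Λ) if and only if (Λ, 𝔪) is of finite type (𝔪 has an additive generator). -/

import Mathlib

open CategoryTheory Limits DirectSum

namespace Paper

variable {Λ : Type} [Ring Λ]

/-- `N` is a direct summand of `P` (there is a section/retraction pair). -/
def IsSummand (N P : ModuleCat Λ) : Prop :=
  ∃ (s : N ⟶ P) (r : P ⟶ N), s ≫ r = 𝟙 N

/-- `Add 𝓧`: all direct summands of arbitrary direct sums of objects of `𝓧`. -/
def AddCl (𝓧 : Set (ModuleCat Λ)) : Set (ModuleCat Λ) :=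
  {N | ∃ (ι : Type) (X : ι → ModuleCat Λ), (∀ i, X i ∈ 𝓧) ∧
        IsSummand N (ModuleCat.of Λ (⨁ i, X i))}

/-- `add 𝓧`: all direct summands of finite direct sums of objects of `𝓧`. -/
def addCl (𝓧 : Set (ModuleCat Λ)) : Set (ModuleCat Λ) :=
  {N | ∃ (k : ℕ) (X : Fin k → ModuleCat Λ), (∀ i, X i ∈ 𝓧) ∧
        IsSummand N (ModuleCat.of Λ (⨁ i, X i))}

/-- Vanishing of `Ext^i(X, Y)` in `Mod Λ`. -/
def extZero (i : ℕ) (X Y : ModuleCat Λ) : Prop :=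
  Limits.IsZero (((Ext ℤ (ModuleCat Λ) i).obj (Opposite.op X)).obj Y)

/-- `𝓜` is an `n`-cluster tilting subcategory of the full subcategory `𝓐 ⊆ Mod Λ`:
it is a generating-cogenerating, functorially finite subcategory of `𝓐` which
coincides with both `Ext`-orthogonality classes (for `1 ≤ i ≤ n-1`) inside `𝓐`. -/
structure IsNClusterTilting (n : ℕ) (𝓐 𝓜 : Set (ModuleCat Λ)) : Prop where
  subset : 𝓜 ⊆ 𝓐
  generating : ∀ A ∈ 𝓐, ∃ M ∈ 𝓜, ∃ f : M ⟶ A, Function.Surjective f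
  cogenerating : ∀ A ∈ 𝓐, ∃ M ∈ 𝓜, ∃ f : A ⟶ M, Function.Injective f
  contFinite : ∀ A ∈ 𝓐, ∃ M ∈ 𝓜, ∃ f : M ⟶ A,
    ∀ N ∈ 𝓜, ∀ g : N ⟶ A, ∃ h : N ⟶ M, h ≫ f = g
  covFinite : ∀ A ∈ 𝓐, ∃ M ∈ 𝓜, ∃ f : A ⟶ M,
    ∀ N ∈ 𝓜, ∀ g : A ⟶ N, ∃ h : M ⟶ N, f ≫ h = g
  char_left : ∀ X ∈ 𝓐, (X ∈ 𝓜 ↔ ∀ i, 0 < i → i < n → ∀ M ∈ 𝓜, extZero i X M)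
  char_right : ∀ X ∈ 𝓐, (X ∈ 𝓜 ↔ ∀ i, 0 < i → i < n → ∀ M ∈ 𝓜, extZero i M X)

/-- The class of finitely generated Λ-modules (the subcategory `mod Λ`). -/
def modFG (Λ : Type) [Ring Λ] : Set (ModuleCat Λ) := {M | Module.Finite Λ M}


/-- An `n`-homological pair `(Λ, 𝔪)` is of finite type if `𝔪` has an additive
generator, i.e. `𝔪 = add M` for some `M ∈ 𝔪`. -/
def FiniteType (𝔪 : Set (ModuleCat Λ)) : Prop :=
  ∃ M ∈ 𝔪, 𝔪 = addCl {M}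


/-- Ext vanishing, via the derived category Ext. -/
def EV (i : ℕ) (X Y : ModuleCat.{0} Λ) : Prop := Subsingleton (Abelian.Ext.{0} X Y i)

lemma extZero_iff (p : ℕ) (X Y : ModuleCat.{0} Λ) : extZero (p+1) X Y ↔ EV (p+1) X Y := by
  let P : ProjectiveResolution X := ProjectiveResolution.of X
  have h1 : extZero (p+1) X Y ↔ ∀ f : P.complex.X (p+1) ⟶ Y, P.complex.d (p+2) (p+1) ≫ f = 0 →
      ∃ g : P.complex.X p ⟶ Y, P.complex.d (p+1) p ≫ g = f := by
    unfold extZero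
    rw [(P.isoExt (R := ℤ) (p+1) Y).isZero_iff, ← HomologicalComplex.exactAt_iff_isZero_homology,
      HomologicalComplex.exactAt_iff' _ p (p+1) (p+2) (by simp) (by simp),
      ShortComplex.moduleCat_exact_iff]
    rfl
  rw [h1]
  constructor
  · intro H
    refine subsingleton_of_forall_eq 0 fun α => ?_
    obtain ⟨f, hf, rfl⟩ := P.extMk_surjective α (p+2) rfl
    rw [P.extMk_eq_zero_iff f (p+2) rfl hf p rfl]
    exact H f hf
  · intro H f hf
    rw [← P.extMk_eq_zero_iff f (p+2) rfl hf p rfl]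
    exact H.elim _ _

lemma extZero_iff' {i : ℕ} (hi : 0 < i) (X Y : ModuleCat.{0} Λ) : extZero i X Y ↔ EV i X Y := by
  obtain ⟨p, rfl⟩ : ∃ p, i = p + 1 := ⟨i - 1, by omega⟩
  exact extZero_iff p X Y

/-- Short exact sequences. -/
structure SES {A B C : ModuleCat.{0} Λ} (f : A ⟶ B) (g : B ⟶ C) : Prop where
  inj : Function.Injective f
  surj : Function.Surjective g
  exact : Function.Exact f g

namespace SES
variable {A B C : ModuleCat.{0} Λ} {f : A ⟶ B} {g : B ⟶ C}

lemma zero (h : SES f g) : f ≫ g = 0 := by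
  ext x; exact h.exact.apply_apply_eq_zero x

lemma se (h : SES f g) : (ShortComplex.mk f g h.zero).ShortExact :=
  ModuleCat.shortComplex_shortExact _ h.exact h.inj h.surj

lemma c3 (h : SES f g) {X : ModuleCat.{0} Λ} {i : ℕ} (h1 : EV i A X) (h2 : EV (i+1) B X) :
    EV (i+1) C X := by
  refine subsingleton_of_forall_eq 0 fun α => ?_
  obtain ⟨x, hx⟩ := Abelian.Ext.contravariant_sequence_exact₃ h.se X α (h2.elim _ _) (add_comm 1 i)
  rw [← hx, h1.elim x 0]; simp

lemma c1 (h : SES f g) {X : ModuleCat.{0} Λ} {i : ℕ} (h1 : EV i B X) (h2 : EV (i+1) C X) :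
    EV i A X := by
  refine subsingleton_of_forall_eq 0 fun α => ?_
  obtain ⟨x, hx⟩ := Abelian.Ext.contravariant_sequence_exact₁ h.se X α (add_comm 1 i) (h2.elim _ _)
  rw [← hx, h1.elim x 0]; simp

lemma cext (h : SES f g) {X : ModuleCat.{0} Λ} (h2 : EV 1 C X) (u : A ⟶ X) :
    ∃ v : B ⟶ X, f ≫ v = u := by
  obtain ⟨x, hx⟩ := Abelian.Ext.contravariant_sequence_exact₁ h.se X
    (Abelian.Ext.mk₀ u) (add_comm 1 0) (h2.elim _ _)
  obtain ⟨v, rfl⟩ := (Abelian.Ext.mk₀_bijective _ _).2 x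
  refine ⟨v, (Abelian.Ext.mk₀_bijective _ _).1 ?_⟩
  rw [← hx]; exact (Abelian.Ext.mk₀_comp_mk₀ _ _).symm

lemma cext' (h : SES f g) {X : ModuleCat.{0} Λ} (h2 : EV 1 B X)
    (H : ∀ u : A ⟶ X, ∃ v : B ⟶ X, f ≫ v = u) : EV 1 C X := by
  refine subsingleton_of_forall_eq 0 fun α => ?_
  obtain ⟨x, hx⟩ := Abelian.Ext.contravariant_sequence_exact₃ h.se X α (h2.elim _ _) (add_comm 1 0)
  obtain ⟨u, rfl⟩ := (Abelian.Ext.mk₀_bijective _ _).2 x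
  obtain ⟨v, rfl⟩ := H u
  rw [← hx, ← Abelian.Ext.mk₀_comp_mk₀]
  exact h.se.extClass_comp_assoc _

lemma v1 (h : SES f g) {N : ModuleCat.{0} Λ} {i : ℕ} (h1 : EV i N C) (h2 : EV (i+1) N B) :
    EV (i+1) N A := by
  refine subsingleton_of_forall_eq 0 fun α => ?_
  obtain ⟨x, hx⟩ := Abelian.Ext.covariant_sequence_exact₁ N h.se α (h2.elim _ _) rfl
  rw [← hx, h1.elim x 0]; simp

lemma v3 (h : SES f g) {N : ModuleCat.{0} Λ} {i : ℕ} (h1 : EV i N B) (h2 : EV (i+1) N A) :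
    EV i N C := by
  refine subsingleton_of_forall_eq 0 fun α => ?_
  obtain ⟨x, hx⟩ := Abelian.Ext.covariant_sequence_exact₃ N h.se α rfl (h2.elim _ _)
  rw [← hx, h1.elim x 0]; simp

lemma vlift (h : SES f g) {N : ModuleCat.{0} Λ} (h2 : EV 1 N A) (u : N ⟶ C) :
    ∃ v : N ⟶ B, v ≫ g = u := by
  obtain ⟨x, hx⟩ := Abelian.Ext.covariant_sequence_exact₃ N h.se
    (Abelian.Ext.mk₀ u) rfl (h2.elim _ _)
  obtain ⟨v, rfl⟩ := (Abelian.Ext.mk₀_bijective _ _).2 x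
  refine ⟨v, (Abelian.Ext.mk₀_bijective _ _).1 ?_⟩
  rw [← hx]; exact (Abelian.Ext.mk₀_comp_mk₀ _ _).symm

lemma vlift' (h : SES f g) {N : ModuleCat.{0} Λ} (h2 : EV 1 N B)
    (H : ∀ u : N ⟶ C, ∃ v : N ⟶ B, v ≫ g = u) : EV 1 N A := by
  refine subsingleton_of_forall_eq 0 fun α => ?_
  obtain ⟨x, hx⟩ := Abelian.Ext.covariant_sequence_exact₁ N h.se α (h2.elim _ _) rfl
  obtain ⟨u, rfl⟩ := (Abelian.Ext.mk₀_bijective _ _).2 x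
  obtain ⟨v, rfl⟩ := H u
  rw [← hx, ← Abelian.Ext.mk₀_comp_mk₀]
  rw [Abelian.Ext.comp_assoc_of_second_deg_zero, h.se.comp_extClass]
  simp

end SES

lemma EV.proj (i : ℕ) (P X : ModuleCat.{0} Λ) [Module.Projective Λ P] : EV (i+1) P X :=
  have : Projective P := (IsProjective.iff_projective (R := Λ) P).1 inferInstance
  Abelian.Ext.subsingleton_of_projective P X i

lemma EV.inj (i : ℕ) (X I : ModuleCat.{0} Λ) [Injective I] : EV (i+1) X I :=
  Abelian.Ext.subsingleton_of_injective X I i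

lemma EV.summand_left {N P X : ModuleCat.{0} Λ} {i : ℕ} (h : IsSummand N P) (hP : EV i P X) :
    EV i N X := by
  obtain ⟨s, r, hsr⟩ := h
  refine subsingleton_of_forall_eq 0 fun α => ?_
  have : (Abelian.Ext.mk₀ s).comp ((Abelian.Ext.mk₀ r).comp α (zero_add i)) (zero_add i) = α := by
    rw [Abelian.Ext.mk₀_comp_mk₀_assoc, hsr]; simp
  rw [← this, hP.elim ((Abelian.Ext.mk₀ r).comp α (zero_add i)) 0]; simp

lemma EV.summand_right {N P X : ModuleCat.{0} Λ} {i : ℕ} (h : IsSummand N P) (hP : EV i X P) :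
    EV i X N := by
  obtain ⟨s, r, hsr⟩ := h
  refine subsingleton_of_forall_eq 0 fun α => ?_
  have : (α.comp (Abelian.Ext.mk₀ s) (add_zero i)).comp (Abelian.Ext.mk₀ r) (add_zero i) = α := by
    rw [Abelian.Ext.comp_assoc_of_third_deg_zero, Abelian.Ext.mk₀_comp_mk₀, hsr]; simp
  rw [← this, hP.elim (α.comp (Abelian.Ext.mk₀ s) (add_zero i)) 0]; simp

lemma SES.ofSurj {B C : ModuleCat.{0} Λ} (g : B ⟶ C) (hg : Function.Surjective g) :
    SES (ModuleCat.ofHom (LinearMap.ker g.hom).subtype) g where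
  inj := Subtype.val_injective
  surj := hg
  exact := by
    intro y
    constructor
    · intro hy; exact ⟨⟨y, hy⟩, rfl⟩
    · rintro ⟨x, rfl⟩; exact x.2

lemma SES.ofInj {A B : ModuleCat.{0} Λ} (f : A ⟶ B) (hf : Function.Injective f) :
    SES f (ModuleCat.ofHom (LinearMap.range f.hom).mkQ) where
  inj := hf
  surj := Submodule.mkQ_surjective _
  exact := by
    intro y
    change (LinearMap.range f.hom).mkQ y = 0 ↔ _
    rw [Submodule.mkQ_apply, Submodule.Quotient.mk_eq_zero]
    rfl

lemma exists_ses_proj (X : ModuleCat.{0} Λ) : ∃ (K P : ModuleCat.{0} Λ) (f : K ⟶ P) (g : P ⟶ X),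
    Module.Projective Λ P ∧ SES f g := by
  have h := SES.ofSurj (ModuleCat.ofHom (Finsupp.linearCombination Λ (id : X → X)))
    (Finsupp.linearCombination_id_surjective Λ X)
  exact ⟨_, ModuleCat.of Λ (X →₀ Λ), _, _, inferInstance, h⟩

lemma exists_ses_proj_fg [IsNoetherianRing Λ] (X : ModuleCat.{0} Λ) [Module.Finite Λ X] :
    ∃ (K P : ModuleCat.{0} Λ) (f : K ⟶ P) (g : P ⟶ X),
    Module.Projective Λ P ∧ Module.Finite Λ P ∧ Module.Finite Λ K ∧ SES f g := by
  obtain ⟨n, f, hf⟩ := Module.Finite.exists_fin' Λ X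
  have h := SES.ofSurj (B := ModuleCat.of Λ (Fin n → Λ)) (ModuleCat.ofHom f) hf
  exact ⟨_, ModuleCat.of Λ (Fin n → Λ), _, _, inferInstance, inferInstance,
    (inferInstance : Module.Finite Λ (LinearMap.ker f)), h⟩

lemma SES.directSum {ι : Type} {A B C : ι → ModuleCat.{0} Λ} {f : ∀ j, A j ⟶ B j}
    {g : ∀ j, B j ⟶ C j} (h : ∀ j, SES (f j) (g j)) :
    SES (ModuleCat.ofHom (DirectSum.lmap fun j => (f j).hom) :
        ModuleCat.of Λ (⨁ j, A j) ⟶ ModuleCat.of Λ (⨁ j, B j))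
        (ModuleCat.ofHom (DirectSum.lmap fun j => (g j).hom) :
        ModuleCat.of Λ (⨁ j, B j) ⟶ ModuleCat.of Λ (⨁ j, C j)) where
  inj := (DirectSum.lmap_injective _).2 fun j => (h j).inj
  surj := (DirectSum.lmap_surjective _).2 fun j => (h j).surj
  exact := by
    classical
    intro y
    change DirectSum.lmap (fun j => (g j).hom) y = 0 ↔
      ∃ x, DirectSum.lmap (fun j => (f j).hom) x = y
    constructor
    · intro hy
      have hy' : ∀ j, ∃ x, (f j).hom x = y j := fun j => ((h j).exact (y j)).1 (by
        exact DFunLike.congr_fun hy j)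
      choose x hx using hy'
      refine ⟨DFinsupp.mk (DFinsupp.support y) fun j => x j, ?_⟩
      ext j
      rw [DirectSum.lmap_apply]
      by_cases hj : j ∈ DFinsupp.support y
      · erw [DFinsupp.mk_of_mem hj]; exact hx j
      · erw [DFinsupp.mk_of_notMem hj, map_zero]; exact (DFinsupp.notMem_support_iff.1 hj).symm
    · rintro ⟨x, rfl⟩
      ext j
      simpa using (h j).exact.apply_apply_eq_zero (x j)

/-- Ext out of a direct sum. -/
lemma EV.directSum (i : ℕ) {ι : Type} (M : ι → ModuleCat.{0} Λ) (X : ModuleCat.{0} Λ)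
    (h : ∀ j, EV (i+1) (M j) X) : EV (i+1) (ModuleCat.of Λ (⨁ j, M j)) X := by
  classical
  induction i generalizing M with
  | zero =>
    choose K P f g hP hS using fun j => exists_ses_proj (M j)
    have hS' := SES.directSum hS
    have : Module.Projective Λ (ModuleCat.of Λ (⨁ j, P j)) :=
      inferInstanceAs (Module.Projective Λ (⨁ j, P j))
    refine hS'.cext' (EV.proj 0 _ _) fun u => ?_
    choose v hv using fun j => (hS j).cext (h j)
      (ModuleCat.ofHom (DirectSum.lof Λ ι (fun j => K j) j) ≫ u)
    refine ⟨ModuleCat.ofHom (DirectSum.toModule Λ ι X fun j => (v j).hom), ?_⟩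
    ext : 1
    refine DirectSum.linearMap_ext Λ fun j => ?_
    ext x
    have := congrArg (fun q => q.hom x) (hv j)
    simpa using this
  | succ i ih =>
    choose K P f g hP hS using fun j => exists_ses_proj (M j)
    have hS' := SES.directSum hS
    have : Module.Projective Λ (ModuleCat.of Λ (⨁ j, P j)) :=
      inferInstanceAs (Module.Projective Λ (⨁ j, P j))
    refine hS'.c3 ?_ (EV.proj _ _ _)
    have hK : ∀ j, EV (i+1) (K j) X := fun j => (hS j).c1 (EV.proj _ _ _) (h j)
    exact ih K hK


/-- Every map from a finitely generated module factors through an object of `𝔪`. -/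
def Loc (𝔪 : Set (ModuleCat.{0} Λ)) (X : ModuleCat.{0} Λ) : Prop :=
  ∀ F : ModuleCat.{0} Λ, Module.Finite Λ F → ∀ u : F ⟶ X,
    ∃ M ∈ 𝔪, ∃ (a : F ⟶ M) (b : M ⟶ X), a ≫ b = u

lemma perp_of_loc [IsNoetherianRing Λ] {𝔪 : Set (ModuleCat.{0} Λ)} {X : ModuleCat.{0} Λ}
    (hX : Loc 𝔪 X) (i : ℕ) (F : ModuleCat.{0} Λ) (hF : Module.Finite Λ F)
    (h : ∀ M ∈ 𝔪, EV (i+1) F M) : EV (i+1) F X := by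
  induction i generalizing F with
  | zero =>
    obtain ⟨K, P, f, g, hP, hPf, hKf, hS⟩ := exists_ses_proj_fg F
    refine hS.cext' (EV.proj 0 _ _) fun u => ?_
    obtain ⟨M, hM, a, b, rfl⟩ := hX K hKf u
    obtain ⟨v, rfl⟩ := hS.cext (h M hM) a
    exact ⟨v ≫ b, by simp⟩
  | succ i ih =>
    obtain ⟨K, P, f, g, hP, hPf, hKf, hS⟩ := exists_ses_proj_fg F
    exact hS.c3 (ih K hKf fun M hM => hS.c1 (EV.proj _ _ _) (h M hM)) (EV.proj _ _ _)

section CT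
variable {n : ℕ} {𝔪 : Set (ModuleCat.{0} Λ)}

lemma CT.ev (h : IsNClusterTilting n (modFG Λ) 𝔪)
    {i : ℕ} (hi : 0 < i) (hin : i < n) {M N : ModuleCat.{0} Λ} (hM : M ∈ 𝔪) (hN : N ∈ 𝔪) :
    EV i M N :=
  (extZero_iff' hi M N).1 ((h.char_left M (h.subset hM)).1 hM i hi hin N hN)

lemma CT.fg (h : IsNClusterTilting n (modFG Λ) 𝔪)
    {M : ModuleCat.{0} Λ} (hM : M ∈ 𝔪) : Module.Finite Λ M := h.subset hM

lemma CT.mem (h : IsNClusterTilting n (modFG Λ) 𝔪)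
    {X : ModuleCat.{0} Λ} (hX : Module.Finite Λ X)
    (H : ∀ i, 0 < i → i < n → ∀ M ∈ 𝔪, EV i X M) : X ∈ 𝔪 :=
  (h.char_left X hX).2 fun i hi hin M hM => (extZero_iff' hi X M).2 (H i hi hin M hM)

lemma CT.proj (h : IsNClusterTilting n (modFG Λ) 𝔪)
    {X : ModuleCat.{0} Λ} (hX : Module.Finite Λ X) (hP : Module.Projective Λ X) :
    X ∈ 𝔪 :=
  CT.mem h hX fun i hi _ M _ => by
    obtain ⟨p, rfl⟩ : ∃ p, i = p + 1 := ⟨i - 1, by omega⟩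
    exact EV.proj _ _ _

lemma CT.summand (h : IsNClusterTilting n (modFG Λ) 𝔪)
    {N M : ModuleCat.{0} Λ} (hN : IsSummand N M) (hM : M ∈ 𝔪) : N ∈ 𝔪 := by
  have hfin : Module.Finite Λ N := by
    obtain ⟨s, r, hsr⟩ := hN
    have := CT.fg h hM
    refine Module.Finite.of_surjective r.hom fun x => ⟨s x, ?_⟩
    exact congrArg (fun q => q.hom x) hsr
  exact CT.mem h hfin fun i hi hin M' hM' => EV.summand_left hN (CT.ev h hi hin hM hM')

lemma CT.sum (h : IsNClusterTilting n (modFG Λ) 𝔪)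
    {ι : Type} [Finite ι] {X : ι → ModuleCat.{0} Λ} (hX : ∀ i, X i ∈ 𝔪) :
    ModuleCat.of Λ (⨁ i, X i) ∈ 𝔪 := by
  have := fun i => CT.fg h (hX i)
  have := Fintype.ofFinite ι
  refine CT.mem h (inferInstanceAs (Module.Finite Λ (⨁ i, X i))) fun i hi hin M' hM' => ?_
  obtain ⟨p, rfl⟩ : ∃ p, i = p + 1 := ⟨i - 1, by omega⟩
  exact EV.directSum p X M' fun j => CT.ev h hi hin (hX j) hM'

lemma CT.left_approx (h : IsNClusterTilting n (modFG Λ) 𝔪)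
    (A : ModuleCat.{0} Λ) (hA : Module.Finite Λ A) :
    ∃ M ∈ 𝔪, ∃ f : A ⟶ M, Function.Injective f ∧
      ∀ N ∈ 𝔪, ∀ g : A ⟶ N, ∃ k : M ⟶ N, f ≫ k = g := by
  obtain ⟨M, hM, f, hf⟩ := h.covFinite A hA
  obtain ⟨M', hM', e, he⟩ := h.cogenerating A hA
  refine ⟨M, hM, f, ?_, hf⟩
  obtain ⟨k, rfl⟩ := hf M' hM' e
  intro x y hxy
  apply he
  simp [hxy]

lemma CT.perp_aux (h : IsNClusterTilting n (modFG Λ) 𝔪)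
    {X : ModuleCat.{0} Λ} (hX : ∀ i, 0 < i → i < n → ∀ M ∈ 𝔪, EV i M X) (k : ℕ) :
    ∀ (j : ℕ), j + k + 1 = n → ∀ (C : ModuleCat.{0} Λ), Module.Finite Λ C →
      (∀ i, 0 < i → i ≤ j → ∀ M ∈ 𝔪, EV i C M) → ∀ i, 0 < i → i ≤ j → EV i C X := by
  induction k with
  | zero =>
    intro j hj C hC H i hi hij
    have : C ∈ 𝔪 := CT.mem h hC fun i hi hin M hM => H i hi (by omega) M hM
    exact hX i hi (by omega) C this
  | succ k ih =>
    intro j hj C hC H i hi hij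
    obtain ⟨M, hM, f, hf, hfM⟩ := CT.left_approx h C hC
    have hS := SES.ofInj f hf
    have := CT.fg h hM
    refine hS.c1 (hX i hi (by omega) M hM) (ih (j+1) (by omega) _
      (inferInstanceAs (Module.Finite Λ (M ⧸ LinearMap.range f.hom))) ?_ (i+1) (by omega) (by omega))
    intro i' hi' hij' N hN
    obtain ⟨p, rfl⟩ : ∃ p, i' = p + 1 := ⟨i' - 1, by omega⟩
    rcases Nat.eq_zero_or_pos p with rfl | hp
    · exact hS.cext' (CT.ev h (by omega) (by omega) hM hN) (hfM N hN)
    · exact hS.c3 (H p hp (by omega) N hN) (CT.ev h (by omega) (by omega) hM hN)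

lemma CT.loc_of_perp (h : IsNClusterTilting n (modFG Λ) 𝔪)
    (hn : 0 < n) {X : ModuleCat.{0} Λ}
    (hX : ∀ i, 0 < i → i < n → ∀ M ∈ 𝔪, EV i M X) : Loc 𝔪 X := by
  intro F hF u
  rcases Nat.lt_or_ge 1 n with h1 | h1
  · obtain ⟨M, hM, f, hf, hfM⟩ := CT.left_approx h F hF
    have hS := SES.ofInj f hf
    have := CT.fg h hM
    have h1 : EV 1 (ModuleCat.of Λ (M ⧸ LinearMap.range f.hom)) X := by
      refine CT.perp_aux h hX (n - 2) 1 (by omega) _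
        (inferInstanceAs (Module.Finite Λ (M ⧸ LinearMap.range f.hom))) ?_ 1 (by omega) (by omega)
      intro i' hi' hij' N hN
      obtain rfl : i' = 1 := by omega
      exact hS.cext' (CT.ev h (by omega) (by omega) hM hN) (hfM N hN)
    obtain ⟨v, hv⟩ := hS.cext h1 u
    exact ⟨M, hM, f, v, hv⟩
  · have : F ∈ 𝔪 := CT.mem h hF fun i hi hin => by omega
    exact ⟨F, this, 𝟙 F, u, by simp⟩

end CT

lemma exists_finset_factor {ι : Type} (X : ι → ModuleCat.{0} Λ) (F : ModuleCat.{0} Λ)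
    (hF : Module.Finite Λ F) (u : F ⟶ ModuleCat.of Λ (⨁ i, X i)) :
    ∃ (s : Finset ι) (a : F ⟶ ModuleCat.of Λ (⨁ i : s, X i))
      (b : ModuleCat.of Λ (⨁ i : s, X i) ⟶ ModuleCat.of Λ (⨁ i, X i)), a ≫ b = u := by
  classical
  have h1 : ∃ s : Finset ι, ∀ x : F, ∀ i ∉ s, (u.hom x : ⨁ i, X i) i = 0 := by
    obtain ⟨t, ht⟩ := hF.fg_top
    refine ⟨t.biUnion fun x => DFinsupp.support (u.hom x : ⨁ i, X i), fun x i hi => ?_⟩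
    have hx : x ∈ Submodule.span Λ (t : Set F) := ht ▸ Submodule.mem_top
    have hle : Submodule.span Λ (t : Set F) ≤
        LinearMap.ker ((DirectSum.component Λ ι (fun i => X i) i).comp u.hom) := by
      rw [Submodule.span_le]
      intro y hy
      simp only [Finset.mem_biUnion, not_exists, not_and] at hi
      exact DFinsupp.notMem_support_iff.1 (hi y hy)
    exact hle hx
  obtain ⟨s, hs⟩ := h1
  refine ⟨s, ModuleCat.ofHom (∑ i : s, (DirectSum.lof Λ s (fun i => X i) i).comp
    ((DirectSum.component Λ ι (fun i => X i) i).comp u.hom)),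
    ModuleCat.ofHom (DirectSum.toModule Λ s _ fun i => DirectSum.lof Λ ι (fun i => X i) i), ?_⟩
  ext x
  have : ∀ y : ⨁ i, X i, (∀ i ∉ s, y i = 0) →
      ∑ i : s, DirectSum.lof Λ ι (fun i => X i) i (y i) = y := by
    intro y hy
    rw [Finset.sum_coe_sort s (fun i => DirectSum.lof Λ ι (fun i => X i) i (y i))]
    ext j
    rw [DFinsupp.finset_sum_apply]
    by_cases hj : j ∈ s
    · rw [Finset.sum_eq_single j]
      · exact DirectSum.of_eq_same _ _
      · intro b _ hb; exact DirectSum.of_eq_of_ne _ _ _ hb.symm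
      · intro h; exact absurd hj h
    · rw [hy j hj]
      exact Finset.sum_eq_zero fun b hb => DirectSum.of_eq_of_ne _ _ _ (by rintro rfl; exact hj hb)
  have h2 := this (u.hom x) (hs x)
  conv_rhs => rw [← h2]
  simp [LinearMap.sum_apply, DirectSum.toModule_lof]
  rfl

lemma CT.loc_of_add {n : ℕ} {𝔪 : Set (ModuleCat.{0} Λ)} (h : IsNClusterTilting n (modFG Λ) 𝔪)
    {X : ModuleCat.{0} Λ} (hX : X ∈ AddCl 𝔪) : Loc 𝔪 X := by
  obtain ⟨ι, Y, hY, s, r, hsr⟩ := hX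
  intro F hF u
  obtain ⟨t, a, b, hab⟩ := exists_finset_factor Y F hF (u ≫ s)
  refine ⟨_, CT.sum h fun i : t => hY i, a, b ≫ r, ?_⟩
  rw [← Category.assoc, hab, Category.assoc, hsr, Category.comp_id]

lemma lift_of_add {𝔪 : Set (ModuleCat.{0} Λ)} {N B X : ModuleCat.{0} Λ} (hN : N ∈ AddCl 𝔪)
    (p : B ⟶ X) (hp : ∀ M ∈ 𝔪, ∀ u : M ⟶ X, ∃ v : M ⟶ B, v ≫ p = u) (u : N ⟶ X) :
    ∃ v : N ⟶ B, v ≫ p = u := by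
  classical
  obtain ⟨ι, Y, hY, s, r, hsr⟩ := hN
  choose v hv using fun i => hp (Y i) (hY i)
    (ModuleCat.ofHom (DirectSum.lof Λ ι (fun i => Y i) i) ≫ r ≫ u)
  refine ⟨s ≫ ModuleCat.ofHom (DirectSum.toModule Λ ι _ fun i => (v i).hom), ?_⟩
  have : ModuleCat.ofHom (DirectSum.toModule Λ ι _ fun i => (v i).hom) ≫ p = r ≫ u := by
    ext : 1
    refine DirectSum.linearMap_ext Λ fun j => ?_
    ext x
    have := congrArg (fun q => q.hom x) (hv j)
    simpa using this
  rw [Category.assoc, this, ← Category.assoc, hsr, Category.id_comp]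

lemma EV.of_add {𝔪 : Set (ModuleCat.{0} Λ)} {i : ℕ} {N X : ModuleCat.{0} Λ} (hN : N ∈ AddCl 𝔪)
    (hX : ∀ M ∈ 𝔪, EV (i+1) M X) : EV (i+1) N X := by
  obtain ⟨ι, Y, hY, hs⟩ := hN
  exact EV.summand_left hs (EV.directSum i Y X fun j => hX _ (hY j))

lemma subset_addCl (𝔪 : Set (ModuleCat.{0} Λ)) {M : ModuleCat.{0} Λ} (hM : M ∈ 𝔪) :
    M ∈ AddCl 𝔪 := by
  refine ⟨Unit, fun _ => M, fun _ => hM, ModuleCat.ofHom (DirectSum.lof Λ Unit (fun _ => M) ()),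
    ModuleCat.ofHom (DirectSum.component Λ Unit (fun _ => M) ()), ?_⟩
  ext x
  simp [DirectSum.component.lof_self]

lemma IsSummand.trans {A B C : ModuleCat.{0} Λ} (h : IsSummand A B) (h' : IsSummand B C) :
    IsSummand A C := by
  obtain ⟨s, r, h⟩ := h
  obtain ⟨s', r', h'⟩ := h'
  exact ⟨s ≫ s', r' ≫ r, by simp [reassoc_of% h', h]⟩


section FlatProj

/-- The equational criterion for flatness. -/
def EqCrit (Γ : Type) [Ring Γ] (N : Type) [AddCommGroup N] [Module Γ N] : Prop :=
  ∀ (ι : Type) [Fintype ι] (φ : ι → Γ) (x : ι → N), ∑ i, φ i • x i = 0 →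
    ∃ (l : ℕ) (u : ι → Fin l → Γ) (g : Fin l → N),
      (∀ i, x i = ∑ j, u i j • g j) ∧ ∀ j, ∑ i, φ i * u i j = 0

variable {Γ : Type} [Ring Γ] {N : Type} [AddCommGroup N] [Module Γ N]

lemma semisimple_of_killed [IsSemiprimaryRing Γ] (M : Type) [AddCommGroup M] [Module Γ M]
    (hM : ∀ a ∈ Ring.jacobson Γ, ∀ x : M, a • x = 0) : IsSemisimpleModule Γ M := by
  have h : Module.IsTorsionBySet Γ M (Ring.jacobson Γ) := by
    intro x a
    exact hM a a.2 x
  let _ := h.module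
  exact (h.semilinearMap.isSemisimpleModule_iff_of_bijective Function.bijective_id).2
      inferInstance

lemma mem_smul_top_sum {E : Type} [AddCommGroup E] [Module Γ E] (I : Ideal Γ) (x : E)
    (hx : x ∈ I • (⊤ : Submodule Γ E)) :
    ∃ c : E →₀ Γ, (∀ e, c e ∈ I) ∧ x = ∑ e : c.support, c e • (e : E) := by
  have : ∃ c : E →₀ Γ, (∀ e, c e ∈ I) ∧ x = Finsupp.linearCombination Γ id c := by
    classical
    induction hx using Submodule.smul_induction_on' with
    | smul r hr n hn =>
      refine ⟨Finsupp.single n r, fun e => ?_, by simp⟩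
      rw [Finsupp.single_apply]
      split_ifs
      · exact hr
      · exact I.zero_mem
    | add x _ y _ hx hy =>
      obtain ⟨c, hc, rfl⟩ := hx
      obtain ⟨d, hd, rfl⟩ := hy
      exact ⟨c + d, fun e => I.add_mem (hc e) (hd e), by simp⟩
  obtain ⟨c, hc, hx⟩ := this
  refine ⟨c, hc, ?_⟩
  rw [hx, Finsupp.linearCombination_apply, Finsupp.sum, ← Finset.sum_coe_sort]
  rfl

lemma split_of_killed [IsSemiprimaryRing Γ] (hN : EqCrit Γ N) {E : Type} [AddCommGroup E]
    [Module Γ E] (π : E →ₗ[Γ] N) (hπ : Function.Surjective π)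
    (hk : ∀ a ∈ Ring.jacobson Γ, ∀ x : E, π x = 0 → a • x = 0) :
    ∃ s : N →ₗ[Γ] E, ∀ y, π (s y) = y := by
  have h0 : ∀ x ∈ Ring.jacobson Γ • (⊤ : Submodule Γ E), π x = 0 → x = 0 := by
    intro x hx hx0
    obtain ⟨c, hc, rfl⟩ := mem_smul_top_sum _ x hx
    rw [map_sum] at hx0
    simp only [map_smul] at hx0
    obtain ⟨l, u, g, h1, h2⟩ := hN _ _ _ hx0
    choose g' hg' using fun j => hπ (g j)
    have h3 : ∀ e : c.support, c e • ((e : E) - ∑ j, u e j • g' j) = 0 := by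
      intro e
      refine hk _ (hc e) _ ?_
      rw [map_sub, h1 e, map_sum]
      simp [hg']
    have h4 : ∀ e : c.support, c e • (e : E) = ∑ j, (c e * u e j) • g' j := by
      intro e
      have := h3 e
      rw [smul_sub, sub_eq_zero] at this
      rw [this, Finset.smul_sum]
      simp [mul_smul]
    rw [Finset.sum_congr rfl fun e _ => h4 e, Finset.sum_comm]
    refine Finset.sum_eq_zero fun j _ => ?_
    rw [← Finset.sum_smul, h2 j, zero_smul]
  set T := Ring.jacobson Γ • (⊤ : Submodule Γ E) with hT
  have hss : IsSemisimpleModule Γ (E ⧸ T) := by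
    refine semisimple_of_killed _ fun a ha x => ?_
    obtain ⟨x, rfl⟩ := T.mkQ_surjective x
    rw [← map_smul]
    exact (Submodule.Quotient.mk_eq_zero _).2 (Submodule.smul_mem_smul ha trivial)
  obtain ⟨C', hC'⟩ := exists_isCompl ((LinearMap.ker π).map T.mkQ)
  let C := C'.comap T.mkQ
  have hinj : Function.Injective (π.domRestrict C) := by
    rw [injective_iff_map_eq_zero]
    rintro ⟨x, hx⟩ hx0
    have hx0 : π x = 0 := hx0
    have : T.mkQ x ∈ (LinearMap.ker π).map T.mkQ ⊓ C' :=
      ⟨⟨x, hx0, rfl⟩, hx⟩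
    rw [hC'.inf_eq_bot, Submodule.mem_bot] at this
    have := h0 x ((Submodule.Quotient.mk_eq_zero _).1 this) hx0
    exact Subtype.ext this
  have hsurj : Function.Surjective (π.domRestrict C) := by
    intro y
    obtain ⟨x, rfl⟩ := hπ y
    have : T.mkQ x ∈ (LinearMap.ker π).map T.mkQ ⊔ C' := by rw [hC'.sup_eq_top]; trivial
    obtain ⟨_, ⟨k, hk, rfl⟩, c, hc, hkc⟩ := Submodule.mem_sup.1 this
    have h5 : x - k ∈ C := by
      change T.mkQ (x - k) ∈ C'
      rw [map_sub, ← hkc]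
      simpa using hc
    refine ⟨⟨x - k, h5⟩, ?_⟩
    have hk : π k = 0 := hk
    simp [hk]
  let e := LinearEquiv.ofBijective _ ⟨hinj, hsurj⟩
  refine ⟨C.subtype.comp e.symm.toLinearMap, fun y => ?_⟩
  exact e.apply_symm_apply y

lemma split_of_pow [IsSemiprimaryRing Γ] (hN : EqCrit Γ N) (m : ℕ) :
    ∀ {E : Type} [AddCommGroup E] [Module Γ E] (π : E →ₗ[Γ] N) (_ : Function.Surjective π)
    (_ : (Ring.jacobson Γ)^m • LinearMap.ker π = ⊥), ∃ s : N →ₗ[Γ] E, ∀ y, π (s y) = y := by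
  induction m with
  | zero =>
    intro E _ _ π hπ hk
    refine split_of_killed hN π hπ fun a _ x hx => ?_
    have : x ∈ (Ring.jacobson Γ)^0 • LinearMap.ker π := by
      rw [Submodule.pow_zero, Ideal.one_eq_top, Submodule.top_smul]; exact hx
    rw [hk, Submodule.mem_bot] at this
    rw [this, smul_zero]
  | succ m ih =>
    intro E _ _ π hπ hk
    set K := Ring.jacobson Γ • LinearMap.ker π with hK
    have hKle : K ≤ LinearMap.ker π := Submodule.smul_le_right
    obtain ⟨s, hs⟩ := split_of_killed hN (K.liftQ π hKle)
      (fun y => by obtain ⟨x, rfl⟩ := hπ y; exact ⟨K.mkQ x, by simp⟩)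
      (by
        intro a ha x hx
        obtain ⟨x, rfl⟩ := K.mkQ_surjective x
        rw [← map_smul]
        refine (Submodule.Quotient.mk_eq_zero _).2 (Submodule.smul_mem_smul ha ?_)
        simpa using hx)
    let E2 := (LinearMap.range s).comap K.mkQ
    have hker : (LinearMap.ker (π.domRestrict E2)).map E2.subtype ≤ K := by
      rintro _ ⟨⟨x, ⟨y, hy⟩⟩, hx, rfl⟩
      have hx : π x = 0 := hx
      have h1 := hs y
      rw [hy] at h1
      have h2 : y = 0 := by rw [← h1]; simpa using hx
      rw [h2, map_zero] at hy
      exact (Submodule.Quotient.mk_eq_zero _).1 hy.symm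
    obtain ⟨t, ht⟩ := ih (π.domRestrict E2)
      (by
        intro y
        obtain ⟨x, hx⟩ := K.mkQ_surjective (s y)
        refine ⟨⟨x, ⟨y, hx.symm⟩⟩, ?_⟩
        have := hs y
        rw [← hx] at this
        simpa using this)
      (by
        rw [eq_bot_iff]
        have : ((Ring.jacobson Γ)^m • LinearMap.ker (π.domRestrict E2)).map E2.subtype ≤ ⊥ := by
          rw [Submodule.map_smul'', ← hk, (Ring.jacobson Γ).pow_succ, Submodule.mul_smul]
          exact Submodule.smul_mono le_rfl hker
        intro x hx
        have := this (Submodule.mem_map_of_mem hx)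
        simpa using this)
    exact ⟨E2.subtype.comp t, ht⟩

lemma projective_of_eqCrit [IsSemiprimaryRing Γ] (hN : EqCrit Γ N) : Module.Projective Γ N := by
  obtain ⟨m, hm⟩ := (IsSemiprimaryRing.isNilpotent (R := Γ))
  obtain ⟨s, hs⟩ := split_of_pow hN m (Finsupp.linearCombination Γ (id : N → N))
    (Finsupp.linearCombination_id_surjective Γ N) (by rw [hm]; simp)
  exact ⟨s, hs⟩

end FlatProj


section RStruct

lemma noeth_of_artin (R : Type) [CommRing R] [IsArtinianRing R] [Algebra R Λ] [Module.Finite R Λ]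
    : IsNoetherianRing Λ :=
  have : IsNoetherian R Λ := inferInstance
  isNoetherian_of_tower R this

lemma artin_of_artin (R : Type) [CommRing R] [IsArtinianRing R] [Algebra R Λ] [Module.Finite R Λ]
    : IsArtinianRing Λ := IsArtinianRing.of_finite R Λ

lemma finite_hom (R : Type) [CommRing R] [IsArtinianRing R] [Algebra R Λ] [Module.Finite R Λ]
    (Z X : Type) [AddCommGroup Z] [Module Λ Z] [AddCommGroup X] [Module Λ X]
    [Module R X] [IsScalarTower R Λ X] [SMulCommClass Λ R X]
    [Module.Finite Λ Z] [Module.Finite Λ X] : Module.Finite R (Z →ₗ[Λ] X) := by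
  have : Module.Finite R X := Module.Finite.trans Λ X
  obtain ⟨k, g, hg⟩ := Module.Finite.exists_fin (R := Λ) (M := Z)
  let ev : (Z →ₗ[Λ] X) →ₗ[R] (Fin k → X) :=
    { toFun := fun f i => f (g i)
      map_add' := fun _ _ => rfl
      map_smul' := fun _ _ => rfl }
  refine Module.Finite.of_injective ev fun f f' hff => ?_
  refine LinearMap.ext_on_range hg fun i => ?_
  exact congrFun hff i

lemma artin_end (R : Type) [CommRing R] [IsArtinianRing R] [Algebra R Λ] [Module.Finite R Λ]
    (M : Type) [AddCommGroup M] [Module Λ M] [Module.Finite Λ M] :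
    IsArtinianRing (Module.End Λ M)ᵈᵐᵃ := by
  let _ : Module R M := Module.compHom M (algebraMap R Λ)
  have : IsScalarTower R Λ M := ⟨fun r l m => by
    rw [Algebra.smul_def, mul_smul]; rfl⟩
  have : SMulCommClass Λ R M := ⟨fun l r m => by
    change l • (algebraMap R Λ r • m) = algebraMap R Λ r • (l • m)
    rw [← mul_smul, ← mul_smul, Algebra.commutes]⟩
  have : Module.Finite R (M →ₗ[Λ] M) := finite_hom R M M
  have : Module.Finite R (Module.End Λ M)ᵐᵒᵖ :=
    Module.Finite.equiv (MulOpposite.opLinearEquiv R : Module.End Λ M ≃ₗ[R] _)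
  exact (IsArtinianRing.of_finite R (Module.End Λ M)ᵐᵒᵖ :)

end RStruct

lemma addCl_single {M N : ModuleCat.{0} Λ} (hN : N ∈ addCl {M}) :
    ∃ (k : ℕ) (σ : Fin k → (N →ₗ[Λ] M)) (ρ : Fin k → (M →ₗ[Λ] N)),
      ∀ x, ∑ j, ρ j (σ j x) = x := by
  classical
  obtain ⟨k, X, hX, s, r, hsr⟩ := hN
  obtain rfl : X = fun _ => M := funext fun i => hX i
  refine ⟨k, fun j => (DirectSum.component Λ (Fin k) (fun _ => M) j).comp s.hom,
    fun j => r.hom.comp (DirectSum.lof Λ (Fin k) (fun _ => M) j), fun x => ?_⟩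
  have h1 : ∀ y : ⨁ _ : Fin k, M, ∑ j, DirectSum.lof Λ (Fin k) (fun _ => M) j (y j) = y :=
    fun y => by
      exact DirectSum.sum_univ_of y
  have h2 := h1 (s.hom x)
  have h3 := congrArg (fun q => q.hom x) hsr
  simp only [LinearMap.comp_apply]
  rw [← map_sum]
  have h4 : ∑ j, DirectSum.lof Λ (Fin k) (fun _ => M) j
    (DirectSum.component Λ (Fin k) (fun _ => M) j (s.hom x)) = s.hom x := h2
  erw [h4]
  exact h3

lemma addCl_of_split {M N : ModuleCat.{0} Λ} (k : ℕ) (σ : Fin k → (N →ₗ[Λ] M))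
    (ρ : Fin k → (M →ₗ[Λ] N)) (h : ∀ x, ∑ j, ρ j (σ j x) = x) : N ∈ addCl {M} := by
  classical
  refine ⟨k, fun _ => M, fun _ => rfl,
    ModuleCat.ofHom (∑ j, (DirectSum.lof Λ (Fin k) (fun _ => M) j).comp (σ j)),
    ModuleCat.ofHom (DirectSum.toModule Λ (Fin k) _ ρ), ?_⟩
  ext x
  simp [h]

section KL

variable {M X : Type} [AddCommGroup M] [Module Λ M] [AddCommGroup X] [Module Λ X]

/-- Post-composition as a linear map over the opposite endomorphism ring. -/
def postComp {Y : Type} [AddCommGroup Y] [Module Λ Y] (p : Y →ₗ[Λ] X) :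
    (M →ₗ[Λ] Y) →ₗ[(Module.End Λ M)ᵈᵐᵃ] (M →ₗ[Λ] X) where
  toFun f := p.comp f
  map_add' _ _ := LinearMap.comp_add _ _ _
  map_smul' _ _ := rfl

lemma section_of_gen {Y : Type} [AddCommGroup Y] [Module Λ Y] (p : Y →ₗ[Λ] X)
    (q : (M →ₗ[Λ] X) → (M →ₗ[Λ] Y)) (hq : ∀ f : M →ₗ[Λ] X, p.comp (q f) = f)
    (hqa : ∀ f f' : M →ₗ[Λ] X, q (f + f') = q f + q f')
    (hqc : ∀ (f : M →ₗ[Λ] X) (e : M →ₗ[Λ] M), q (f.comp e) = (q f).comp e)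
    {k : ℕ} (a : Fin k → M) (b : Fin k → (M →ₗ[Λ] Λ)) (hab : ∑ j, b j (a j) = 1) :
    ∃ t : X →ₗ[Λ] Y, ∀ x, p (t x) = x := by
  have hqs : ∀ {ι : Type} (s : Finset ι) (f : ι → (M →ₗ[Λ] X)),
      q (∑ i ∈ s, f i) = ∑ i ∈ s, q (f i) := fun s f => map_sum (AddMonoidHom.mk' q hqa) f s
  let H : X → Fin k → (M →ₗ[Λ] X) := fun x j => (LinearMap.toSpanSingleton Λ X x).comp (b j)
  refine ⟨{ toFun := fun x => ∑ j, q (H x j) (a j), map_add' := ?_, map_smul' := ?_ }, ?_⟩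
  · intro x y
    rw [← Finset.sum_add_distrib]
    refine Finset.sum_congr rfl fun j _ => ?_
    rw [← LinearMap.add_apply, ← hqa]
    congr 2
    ext m
    simp [H]
  · intro l x
    have h1 : ∀ j, H (l • x) j = ∑ i, (H x i).comp
        ((LinearMap.toSpanSingleton Λ M (l • a i)).comp (b j)) := by
      intro j
      ext m
      simp only [H, LinearMap.comp_apply, LinearMap.toSpanSingleton_apply, LinearMap.sum_apply,
        map_smul]
      rw [← Finset.smul_sum, ← Finset.smul_sum, ← Finset.sum_smul, hab, one_smul]
    have h2 : ∀ j, q (H (l • x) j) (a j) = ∑ i, (b j (a j)) • q (H x i) (l • a i) := by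
      intro j
      rw [h1 j, hqs, LinearMap.sum_apply]
      refine Finset.sum_congr rfl fun i _ => ?_
      rw [hqc]
      simp
    rw [Finset.sum_congr rfl fun j _ => h2 j, Finset.sum_comm]
    simp only [← Finset.sum_smul, hab, one_smul, map_smul, RingHom.id_apply, Finset.smul_sum]
  · intro x
    simp only [LinearMap.coe_mk, AddHom.coe_mk, map_sum]
    have h1 : ∀ j, p (q (H x j) (a j)) = b j (a j) • x := fun j =>
      congrArg (fun f => f (a j)) (hq (H x j))
    rw [Finset.sum_congr rfl fun j _ => h1 j, ← Finset.sum_smul, hab, one_smul]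

end KL

lemma eqCrit_of_loc {M X : ModuleCat.{0} Λ} (hM : Module.Finite Λ M) (hX : Loc (addCl {M}) X) :
    EqCrit (Module.End Λ M)ᵈᵐᵃ (M →ₗ[Λ] X) := by
  classical
  intro ι _ φ x hx
  let ψ : M →ₗ[Λ] (ι → M) := LinearMap.pi fun i => DomMulAct.mk.symm (φ i)
  let w : (ι → M) →ₗ[Λ] X := ∑ i, (x i).comp (LinearMap.proj i)
  have hw : LinearMap.range ψ ≤ LinearMap.ker w := by
    rintro _ ⟨m, rfl⟩
    have := congrArg (fun f => f m) hx
    simpa [w, ψ, LinearMap.sum_apply, DomMulAct.smul_linearMap_apply] using this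
  let F := ModuleCat.of Λ ((ι → M) ⧸ LinearMap.range ψ)
  have hF : Module.Finite Λ F := inferInstanceAs (Module.Finite Λ ((ι → M) ⧸ LinearMap.range ψ))
  obtain ⟨N, hN, a, b, hab⟩ := hX F hF (ModuleCat.ofHom ((LinearMap.range ψ).liftQ w hw))
  obtain ⟨l, σ, ρ, hσρ⟩ := addCl_single hN
  let c : (ι → M) →ₗ[Λ] N := a.hom.comp (LinearMap.range ψ).mkQ
  have hc : ∀ y, b.hom (c y) = w y := fun y => by
    have := congrArg (fun f => f.hom ((LinearMap.range ψ).mkQ y)) hab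
    exact this
  have hcψ : ∀ m, c (ψ m) = 0 := fun m => by
    have : (LinearMap.range ψ).mkQ (ψ m) = 0 :=
      (Submodule.Quotient.mk_eq_zero _).2 ⟨m, rfl⟩
    simp only [c, LinearMap.comp_apply, this]
    exact map_zero _
  refine ⟨l, fun i j => DomMulAct.mk ((σ j).comp (c.comp (LinearMap.single Λ (fun _ => M) i))),
    fun j => b.hom.comp (ρ j), fun i => ?_, fun j => ?_⟩
  · ext m
    simp only [LinearMap.sum_apply, DomMulAct.mk_smul_linearMap_apply]
    have h1 : w (Pi.single i m) = x i m := by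
      simp only [w, LinearMap.sum_apply, LinearMap.comp_apply, LinearMap.proj_apply]
      rw [Finset.sum_eq_single i]
      · simp
      · intro j _ hj; simp [Pi.single_eq_of_ne hj]
      · simp
    rw [← h1, ← hc]
    conv_lhs => rw [← hσρ (c (Pi.single i m)), map_sum]
    rfl
  · apply DomMulAct.mk.symm.injective
    ext m
    have h2 : (σ j) (c (ψ m)) = 0 := by rw [hcψ, map_zero]
    have h3 : ψ m = ∑ i, Pi.single i (DomMulAct.mk.symm (φ i) m) := by
      rw [Finset.univ_sum_single]; rfl
    rw [h3, map_sum, map_sum] at h2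
    have h4 : ∀ (f : ι → (Module.End Λ M)ᵈᵐᵃ),
        DomMulAct.mk.symm (∑ i, f i) = ∑ i, DomMulAct.mk.symm (f i) := fun f =>
      map_sum (MulOpposite.opAddEquiv.symm : (Module.End Λ M)ᵐᵒᵖ ≃+ Module.End Λ M) f _
    rw [h4, LinearMap.sum_apply]
    exact h2

/-- Main structural lemma: if `𝔪 = add M` then the locally-`𝔪` modules are in `Add 𝔪`. -/
lemma KL (R : Type) [CommRing R] [IsArtinianRing R] [Algebra R Λ] [Module.Finite R Λ]
    {M X : ModuleCat.{0} Λ} (hM : Module.Finite Λ M)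
    (hΛ : ModuleCat.of Λ Λ ∈ addCl {M}) (hX : Loc (addCl {M}) X) : X ∈ AddCl {M} := by
  classical
  have := artin_end R (Λ := Λ) M
  have hP : Module.Projective (Module.End Λ M)ᵈᵐᵃ (M →ₗ[Λ] X) :=
    projective_of_eqCrit (eqCrit_of_loc hM hX)
  let p : (⨁ _ : (M →ₗ[Λ] X), M) →ₗ[Λ] X := DirectSum.toModule Λ _ _ fun h => h
  obtain ⟨q, hq⟩ := Module.projective_lifting_property (postComp (M := M) p) LinearMap.id
    (fun h => ⟨DirectSum.lof Λ _ (fun _ => M) h, by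
      apply LinearMap.ext; intro m
      have : p (DirectSum.lof Λ _ (fun _ => M) h m) = h m := by
        simp only [p]; rw [DirectSum.toModule_lof]
      exact this⟩)
  obtain ⟨k, σ, ρ, hσρ⟩ := addCl_single hΛ
  obtain ⟨t, ht⟩ := section_of_gen p q.toFun (fun f => congrArg (fun g => g.toFun f) hq)
    q.map_add' (fun f e => q.map_smul' (DomMulAct.mk e) f)
    (fun j => σ j (1 : Λ)) ρ (hσρ (1 : Λ))
  refine ⟨(M →ₗ[Λ] X), fun _ => M, fun _ => rfl, ModuleCat.ofHom t, ModuleCat.ofHom p, ?_⟩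
  ext x
  exact ht x


section Backward

variable {n : ℕ} {𝔪 : Set (ModuleCat.{0} Λ)}

lemma AddCl.summand {N P : ModuleCat.{0} Λ} (h : IsSummand N P) (hP : P ∈ AddCl 𝔪) :
    N ∈ AddCl 𝔪 := by
  obtain ⟨ι, X, hX, hs⟩ := hP
  exact ⟨ι, X, hX, h.trans hs⟩

lemma AddCl.mono {𝔫 : Set (ModuleCat.{0} Λ)} (h : 𝔪 ⊆ 𝔫) : AddCl 𝔪 ⊆ AddCl 𝔫 := by
  rintro N ⟨ι, X, hX, hs⟩
  exact ⟨ι, X, fun i => h (hX i), hs⟩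

lemma SES.retract {A B C : ModuleCat.{0} Λ} {f : A ⟶ B} {g : B ⟶ C} (hS : SES f g)
    (v : C ⟶ B) (hv : v ≫ g = 𝟙 C) : ∃ r : B ⟶ A, f ≫ r = 𝟙 A := by
  have := hS.se.mono_f
  have h0 := hS.zero
  let r : B ⟶ A := hS.se.exact.lift (𝟙 B - g ≫ v) (by simp [hv])
  have hr : r ≫ f = 𝟙 B - g ≫ v := hS.se.exact.lift_f _ _
  have hm : Mono f := hS.se.mono_f
  refine ⟨r, ?_⟩
  rw [← cancel_mono f, Category.assoc, hr]
  simp [reassoc_of% h0]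

lemma CT.ev_add [IsNoetherianRing Λ] (h : IsNClusterTilting n (modFG Λ) 𝔪)
    {i : ℕ} (hi : 0 < i) (hin : i < n) {M N : ModuleCat.{0} Λ} (hM : M ∈ AddCl 𝔪)
    (hN : N ∈ AddCl 𝔪) : EV i M N := by
  obtain ⟨p, rfl⟩ : ∃ p, i = p + 1 := ⟨i - 1, by omega⟩
  exact EV.of_add hM fun M' hM' => perp_of_loc (CT.loc_of_add h hN) p M' (CT.fg h hM')
    fun M'' hM'' => CT.ev h hi hin hM' hM''

lemma CT.loc_pi (h : IsNClusterTilting n (modFG Λ) 𝔪) {M : ModuleCat.{0} Λ} (hM : M ∈ 𝔪)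
    (J : Type) : Loc 𝔪 (ModuleCat.of Λ (J → M)) := by
  intro F hF u
  obtain ⟨M', hM', f, -, hf⟩ := CT.left_approx h F hF
  choose k hk using fun j => hf M hM (ModuleCat.ofHom ((LinearMap.proj j).comp u.hom))
  refine ⟨M', hM', f, ModuleCat.ofHom (LinearMap.pi fun j => (k j).hom), ?_⟩
  ext x j
  exact congrArg (fun q => q.hom x) (hk j)

/-- The inclusion of the direct sum into the product. -/
noncomputable def inclSum (M : ModuleCat.{0} Λ) (J : Type) :
    ModuleCat.of Λ (⨁ _ : J, M) ⟶ ModuleCat.of Λ (J → M) :=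
  ModuleCat.ofHom (LinearMap.pi fun j => DirectSum.component Λ J (fun _ => M) j)

lemma inclSum_inj (M : ModuleCat.{0} Λ) (J : Type) : Function.Injective (inclSum M J) := by
  intro x y hxy
  exact DFinsupp.ext fun j => congrFun hxy j

lemma inclSum_range (M : ModuleCat.{0} Λ) (J : Type) (s : Finset J) (y : J → M)
    (hy : ∀ j ∉ s, y j = 0) : y ∈ LinearMap.range (inclSum M J).hom := by
  classical
  refine ⟨∑ j ∈ s, DirectSum.lof Λ J (fun _ => M) j (y j), ?_⟩
  funext i
  change DirectSum.component Λ J (fun _ => M) i (∑ j ∈ s, DirectSum.lof Λ J (fun _ => M) j (y j)) = _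
  rw [map_sum]
  by_cases hi : i ∈ s
  · rw [Finset.sum_eq_single i]
    · exact DirectSum.component.lof_self ..
    · intro b _ hb
      rw [DirectSum.component.of, dif_neg hb]
    · intro h; exact absurd hi h
  · rw [hy i hi]
    refine Finset.sum_eq_zero fun b hb => ?_
    rw [DirectSum.component.of, dif_neg]
    rintro rfl; exact hi hb

lemma lift_pi_mod [IsNoetherianRing Λ] (M : ModuleCat.{0} Λ) (J : Type) (F : ModuleCat.{0} Λ)
    (hF : Module.Finite Λ F)
    (u : F ⟶ ModuleCat.of Λ ((J → M) ⧸ LinearMap.range (inclSum M J).hom)) :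
    ∃ v : F ⟶ ModuleCat.of Λ (J → M),
      v ≫ ModuleCat.ofHom (LinearMap.range (inclSum M J).hom).mkQ = u := by
  classical
  let T : Submodule Λ (J → M) := LinearMap.range (inclSum M J).hom
  obtain ⟨b, π, hπ⟩ := Module.Finite.exists_fin' Λ F
  obtain ⟨w, hw⟩ := Module.projective_lifting_property T.mkQ (u.hom.comp π) T.mkQ_surjective
  have hw' : ∀ x, T.mkQ (w x) = u.hom (π x) := fun x => congrArg (fun q => q x) hw
  obtain ⟨t, ht⟩ := (IsNoetherian.noetherian (LinearMap.ker π) : (LinearMap.ker π).FG)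
  have h1 : ∀ x ∈ LinearMap.ker π, w x ∈ T := by
    intro x hx
    rw [← Submodule.Quotient.mk_eq_zero]
    have := hw' x
    rw [LinearMap.mem_ker.1 hx, map_zero] at this
    exact this
  have h2 : ∃ s : Finset J, ∀ x ∈ LinearMap.ker π, ∀ j ∉ s, w x j = 0 := by
    have h3 : ∀ x, ∃ s : Finset J, x ∈ LinearMap.ker π → ∀ j ∉ s, w x j = 0 := by
      intro x
      by_cases hx : x ∈ LinearMap.ker π
      · obtain ⟨y, hy⟩ := h1 x hx
        refine ⟨DFinsupp.support (y : ⨁ _ : J, M), fun _ j hj => ?_⟩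
        rw [← hy]
        exact DFinsupp.notMem_support_iff.1 hj
      · exact ⟨∅, fun h => absurd h hx⟩
    choose s hs using h3
    refine ⟨t.biUnion s, fun x hx j hj => ?_⟩
    rw [← ht] at hx
    have hle : Submodule.span Λ (t : Set (Fin b → Λ)) ≤
        LinearMap.ker ((LinearMap.proj j : (J → M) →ₗ[Λ] M).comp w) := by
      rw [Submodule.span_le]
      intro y hy
      refine hs y (by rw [← ht]; exact Submodule.subset_span hy) j fun h => hj ?_
      exact Finset.mem_biUnion.2 ⟨y, hy, h⟩
    exact hle hx
  obtain ⟨s, hs⟩ := h2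
  let z : (J → M) →ₗ[Λ] (J → M) := LinearMap.pi fun j => if j ∈ s then 0 else LinearMap.proj j
  have hz0 : ∀ y j, j ∈ s → z y j = 0 := fun y j hj => by simp [z, hj]
  have hz1 : ∀ y j, j ∉ s → z y j = y j := fun y j hj => by simp [z, hj]
  have hk : LinearMap.ker π ≤ LinearMap.ker (z.comp w) := by
    intro x hx
    rw [LinearMap.mem_ker, LinearMap.comp_apply]
    funext j
    by_cases hj : j ∈ s
    · exact hz0 _ _ hj
    · rw [hz1 _ _ hj]; exact hs x hx j hj
  let e := π.quotKerEquivOfSurjective hπ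
  refine ⟨ModuleCat.ofHom (((LinearMap.ker π).liftQ (z.comp w) hk).comp e.symm.toLinearMap), ?_⟩
  ext y
  obtain ⟨x, rfl⟩ := hπ y
  have he : e.symm (π x) = (LinearMap.ker π).mkQ x := by
    rw [LinearEquiv.symm_apply_eq]; rfl
  have h5 : T.mkQ (z (w x)) = T.mkQ (w x) := by
    refine (Submodule.Quotient.eq T).2 (inclSum_range M J s _ fun j hj => ?_)
    rw [Pi.sub_apply, hz1 _ _ hj, sub_self]
  have h6 : ((LinearMap.ker π).liftQ (z.comp w) hk) (e.symm (π x)) = z (w x) := by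
    rw [he]; rfl
  change T.mkQ (((LinearMap.ker π).liftQ (z.comp w) hk) (e.symm (π x))) = _
  rw [h6, h5, hw']

theorem backward (R : Type) [CommRing R] [IsArtinianRing R] [Algebra R Λ] [Module.Finite R Λ]
    (hn : 0 < n) (h : IsNClusterTilting n (modFG Λ) 𝔪) (hf : FiniteType 𝔪) :
    IsNClusterTilting n Set.univ (AddCl 𝔪) := by
  classical
  have hnoe : IsNoetherianRing Λ := noeth_of_artin R
  obtain ⟨M, hM, hm⟩ := hf
  have hMfg := CT.fg h hM
  have hΛ : ModuleCat.of Λ Λ ∈ 𝔪 := CT.proj h (inferInstanceAs (Module.Finite Λ Λ))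
    (inferInstanceAs (Module.Projective Λ Λ))
  have hL1 : ∀ X, Loc 𝔪 X → X ∈ AddCl {M} := fun X hX =>
    KL R hMfg (hm ▸ hΛ) (hm ▸ hX)
  have h1m : AddCl {M} ⊆ AddCl 𝔪 := AddCl.mono (by rintro _ rfl; exact hM)
  have hm1 : AddCl 𝔪 ⊆ AddCl {M} := fun X hX => hL1 X (CT.loc_of_add h hX)
  have hL : ∀ X, Loc 𝔪 X → X ∈ AddCl 𝔪 := fun X hX => h1m (hL1 X hX)
  have hR : ∀ X : ModuleCat.{0} Λ, (∀ i, 0 < i → i < n → ∀ N ∈ AddCl 𝔪, EV i N X) → X ∈ AddCl 𝔪 :=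
    fun X hX => hL X (CT.loc_of_perp h hn fun i hi hin N hN =>
      hX i hi hin N (subset_addCl 𝔪 hN))
  have rap : ∀ A : ModuleCat.{0} Λ, ∃ B ∈ AddCl 𝔪, ∃ p : B ⟶ A, Function.Surjective p ∧
      ∀ N ∈ AddCl 𝔪, ∀ g : N ⟶ A, ∃ k : N ⟶ B, k ≫ p = g := by
    intro A
    let p : ModuleCat.of Λ (⨁ _ : (M ⟶ A), M) ⟶ A :=
      ModuleCat.ofHom (DirectSum.toModule Λ _ _ fun f : (M ⟶ A) => f.hom)
    have hp : ∀ N ∈ AddCl 𝔪, ∀ g : N ⟶ A, ∃ k : N ⟶ _, k ≫ p = g := by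
      intro N hN g
      refine lift_of_add (hm1 hN) p ?_ g
      intro M' hM' u
      obtain rfl : M' = M := hM'
      refine ⟨ModuleCat.ofHom (DirectSum.lof Λ _ (fun _ => M') u), ?_⟩
      ext x
      simp [p]
    refine ⟨_, ⟨(M ⟶ A), fun _ => M, fun _ => hM, 𝟙 _, 𝟙 _, by simp⟩, p, ?_, hp⟩
    intro a
    obtain ⟨k, hk⟩ := hp _ (subset_addCl 𝔪 hΛ) (ModuleCat.ofHom (LinearMap.toSpanSingleton Λ A a))
    refine ⟨k.hom (1 : Λ), ?_⟩
    have := congrArg (fun q => q.hom (1 : Λ)) hk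
    refine this.trans ?_
    exact one_smul Λ a
  have aux : ∀ X : ModuleCat.{0} Λ, (∀ i, 0 < i → i < n → ∀ N ∈ AddCl 𝔪, EV i X N) → ∀ k j : ℕ,
      j + k + 1 = n → ∀ K : ModuleCat.{0} Λ, (∀ i, 0 < i → i ≤ j → ∀ N ∈ AddCl 𝔪, EV i N K) →
      ∀ i, 0 < i → i ≤ j → EV i X K := by
    intro X hX k
    induction k with
    | zero =>
      intro j hj K H i hi hij
      exact hX i hi (by omega) K (hR K fun i hi hin N hN => H i hi (by omega) N hN)
    | succ k ih =>
      intro j hj K H i hi hij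
      obtain ⟨B, hB, p, hps, hp⟩ := rap K
      have hS := SES.ofSurj p hps
      refine hS.v3 (hX i hi (by omega) B hB) (ih (j+1) (by omega) _ ?_ (i+1) (by omega) (by omega))
      intro i' hi' hij' N hN
      obtain ⟨q, rfl⟩ : ∃ p, i' = p + 1 := ⟨i' - 1, by omega⟩
      rcases Nat.eq_zero_or_pos q with rfl | hq
      · exact hS.vlift' (CT.ev_add h (by omega) (by omega) hN hB) (hp N hN)
      · exact hS.v1 (H q hq (by omega) N hN) (CT.ev_add h (by omega) (by omega) hN hB)
  have hLft : ∀ X : ModuleCat.{0} Λ, (∀ i, 0 < i → i < n → ∀ N ∈ AddCl 𝔪, EV i X N) →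
      X ∈ AddCl 𝔪 := by
    intro X hX
    rcases Nat.lt_or_ge 1 n with h1 | h1
    · obtain ⟨B, hB, p, hps, hp⟩ := rap X
      have hS := SES.ofSurj p hps
      have h1 : EV 1 X (ModuleCat.of Λ (LinearMap.ker p.hom)) := by
        refine aux X hX (n - 2) 1 (by omega) _ ?_ 1 (by omega) (by omega)
        intro i' hi' hij' N hN
        obtain rfl : i' = 1 := by omega
        exact hS.vlift' (CT.ev_add h (by omega) (by omega) hN hB) (hp N hN)
      obtain ⟨v, hv⟩ := hS.vlift h1 (𝟙 X)
      exact AddCl.summand ⟨v, p, hv⟩ hB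
    · exact hR X fun i hi hin => by omega
  refine ⟨fun _ _ => trivial, ?_, ?_, ?_, ?_, ?_, ?_⟩
  · intro A _
    obtain ⟨B, hB, p, hps, -⟩ := rap A
    exact ⟨B, hB, p, hps⟩
  · intro A _
    refine ⟨Injective.under A, hR _ fun i hi hin N hN => ?_, Injective.ι A, ?_⟩
    · obtain ⟨p, rfl⟩ : ∃ p, i = p + 1 := ⟨i - 1, by omega⟩
      exact EV.inj _ _ _
    · exact (ModuleCat.mono_iff_injective _).1 inferInstance
  · intro A _
    obtain ⟨B, hB, p, -, hp⟩ := rap A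
    exact ⟨B, hB, p, hp⟩
  · intro A _
    refine ⟨ModuleCat.of Λ ((A ⟶ M) → M), hL _ (CT.loc_pi h hM _),
      ModuleCat.ofHom (LinearMap.pi fun f : (A ⟶ M) => f.hom), ?_⟩
    intro N hN g
    obtain ⟨J, X, hX, s, r, hsr⟩ := hm1 hN
    obtain rfl : X = fun _ => M := funext fun i => hX i
    have hS := SES.ofInj _ (inclSum_inj M J)
    have hQ : Loc 𝔪 (ModuleCat.of Λ ((J → M) ⧸ LinearMap.range (inclSum M J).hom)) := by
      intro F hF u
      obtain ⟨v, rfl⟩ := lift_pi_mod M J F hF u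
      obtain ⟨M', hM', a, b, rfl⟩ := CT.loc_pi h hM J F hF v
      exact ⟨M', hM', a, b ≫ _, (Category.assoc _ _ _).symm⟩
    obtain ⟨v, hv⟩ := lift_of_add (hL _ hQ)
      (ModuleCat.ofHom (LinearMap.range (inclSum M J).hom).mkQ)
      (fun M' hM' u => lift_pi_mod M J M' (CT.fg h hM') u) (𝟙 _)
    obtain ⟨ret, hret⟩ := hS.retract v hv
    let k : ModuleCat.of Λ ((A ⟶ M) → M) ⟶ ModuleCat.of Λ (J → M) :=
      ModuleCat.ofHom (LinearMap.pi fun j => LinearMap.proj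
        (g ≫ s ≫ inclSum M J ≫ ModuleCat.ofHom (LinearMap.proj j)))
    have hk : ModuleCat.ofHom (LinearMap.pi fun f : (A ⟶ M) => f.hom) ≫ k
        = g ≫ s ≫ inclSum M J := by
      ext x j
      rfl
    refine ⟨k ≫ ret ≫ r, ?_⟩
    rw [reassoc_of% hk, reassoc_of% hret, hsr, Category.comp_id]
  · intro X _
    refine ⟨fun hX i hi hin N hN => (extZero_iff' hi _ _).2 (CT.ev_add h hi hin hX hN), fun H =>
      hLft X fun i hi hin N hN => (extZero_iff' hi _ _).1 (H i hi hin N hN)⟩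
  · intro X _
    refine ⟨fun hX i hi hin N hN => (extZero_iff' hi _ _).2 (CT.ev_add h hi hin hN hX), fun H =>
      hR X fun i hi hin N hN => (extZero_iff' hi _ _).1 (H i hi hin N hN)⟩

end Backward


section InjHull

variable {R : Type} [CommRing R] [IsArtinianRing R]

lemma noeth_hom {U : Type} [AddCommGroup U] [Module R U] (i : U)
    (hU : ∀ x : U, x ≠ 0 → ∃ r : R, r • x = i) (hi : i ≠ 0) (F : Type) [AddCommGroup F] [Module R F]
    [hF : Module.Finite R F] : IsNoetherian R (F →ₗ[R] U) := by
  induction hF using IsNoetherianRing.induction_on_isQuotientEquivQuotientPrime R with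
  | subsingleton N => infer_instance
  | quotient N p e =>
    have hpm : p.1.IsMaximal := by
      have := p.2
      infer_instance
    have h1 : ∀ f : N →ₗ[R] U, f (e.symm (p.1.mkQ 1)) ∈ Submodule.span R {i} := by
      intro f
      set x := f (e.symm (p.1.mkQ 1)) with hx
      by_cases hx0 : x = 0
      · rw [hx0]; exact Submodule.zero_mem _
      have hk : ∀ r ∈ p.1, r • x = 0 := by
        intro r hr
        rw [hx, ← map_smul, ← map_smul, ← map_smul]
        have : p.1.mkQ (r • (1 : R)) = 0 := by
          rw [smul_eq_mul, mul_one]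
          exact (Submodule.Quotient.mk_eq_zero _).2 hr
        rw [this, map_zero, map_zero]
      obtain ⟨r, hr⟩ := hU x hx0
      have hr' : r ∉ p.1 := fun h => hi (by rw [← hr, hk r h])
      obtain ⟨s, hs⟩ := hpm.exists_inv hr'
      obtain ⟨t, ht, hst⟩ := hs
      refine Submodule.mem_span_singleton.2 ⟨s, ?_⟩
      rw [← hr, ← mul_smul]
      have := congrArg (fun z => z • x) hst
      simpa [add_smul, hk t ht] using this
    let ev : (N →ₗ[R] U) →ₗ[R] Submodule.span R {i} :=
      { toFun := fun f => ⟨f (e.symm (p.1.mkQ 1)), h1 f⟩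
        map_add' := fun _ _ => rfl
        map_smul' := fun _ _ => rfl }
    refine isNoetherian_of_injective ev ?_
    rw [injective_iff_map_eq_zero]
    intro f hf
    have hf : f (e.symm (p.1.mkQ 1)) = 0 := congrArg Subtype.val hf
    ext n
    obtain ⟨r, hr⟩ := p.1.mkQ_surjective (e n)
    have : n = r • e.symm (p.1.mkQ 1) := by
      rw [← map_smul, ← map_smul, smul_eq_mul, mul_one, hr, e.symm_apply_apply]
    rw [this, map_smul, hf, smul_zero, LinearMap.zero_apply]
  | exact N₁ N₂ N₃ f g hf hg hfg h₁ h₃ =>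
    refine isNoetherian_of_range_eq_ker (LinearMap.lcomp R U g) (LinearMap.lcomp R U f) ?_
    ext w
    constructor
    · rintro ⟨v, rfl⟩
      ext x
      simp [hfg.apply_apply_eq_zero]
    · intro hw
      have hw : ∀ x, w (f x) = 0 := fun x => congrArg (fun q => q x) (LinearMap.mem_ker.1 hw)
      have hk : LinearMap.ker g ≤ LinearMap.ker w := by
        intro y hy
        obtain ⟨x, rfl⟩ := (hfg y).1 hy
        exact hw x
      refine ⟨((LinearMap.ker g).liftQ w hk).comp (g.quotKerEquivOfSurjective hg).symm.toLinearMap, ?_⟩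
      ext y
      have he : (g.quotKerEquivOfSurjective hg).symm (g y) = (LinearMap.ker g).mkQ y := by
        rw [LinearEquiv.symm_apply_eq]; rfl
      simp only [LinearMap.lcomp_apply, LinearMap.comp_apply, LinearEquiv.coe_coe]
      rw [he]
      rfl

/-- A finitely generated injective module containing a copy of `R ⧸ m`. -/
lemma exists_fg_injective (m : Ideal R) [hm : m.IsMaximal] :
    ∃ (E : Type) (_ : AddCommGroup E) (_ : Module R E), Module.Finite R E ∧ Module.Injective R E ∧
      ∃ e : E, e ≠ 0 ∧ ∀ r ∈ m, r • e = 0 := by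
  obtain ⟨I, _, _, hI, i, hi, him⟩ : ∃ (I : Type) (_ : AddCommGroup I) (_ : Module R I),
      Module.Injective R I ∧ ∃ i : I, i ≠ 0 ∧ ∀ r ∈ m, r • i = 0 := by
    let A := ModuleCat.of R (R ⧸ m)
    have hinj : Function.Injective (Injective.ι A) :=
      (ModuleCat.mono_iff_injective _).1 inferInstance
    have hob : Injective (ModuleCat.of R ((Injective.under A : ModuleCat.{0} R) : Type)) :=
      (inferInstance : Injective (Injective.under A))
    refine ⟨((Injective.under A : ModuleCat.{0} R) : Type), inferInstance, inferInstance,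
      Module.injective_module_of_injective_object R _, Injective.ι A (m.mkQ 1), ?_, ?_⟩
    · intro h
      have : (m.mkQ 1) = 0 := hinj (by rw [h]; exact (map_zero (Injective.ι A).hom).symm)
      exact hm.ne_top ((Ideal.eq_top_iff_one m).2 ((Submodule.Quotient.mk_eq_zero _).1 this))
    · intro r hr
      have h1 : r • m.mkQ 1 = 0 := by
        rw [← map_smul, smul_eq_mul, mul_one]
        exact (Submodule.Quotient.mk_eq_zero _).2 hr
      have h2 : (Injective.ι A).hom (r • m.mkQ 1) = r • (Injective.ι A).hom (m.mkQ 1) := map_smul _ _ _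
      rw [h1, map_zero] at h2
      exact h2.symm
  let P : Set (Submodule R I) := {U | i ∈ U ∧ ∀ x ∈ U, x ≠ 0 → ∃ r : R, r • x = i}
  have hP0 : Submodule.span R {i} ∈ P := by
    refine ⟨Submodule.mem_span_singleton_self i, ?_⟩
    intro x hx hx0
    obtain ⟨r, rfl⟩ := Submodule.mem_span_singleton.1 hx
    have hr' : r ∉ m := fun h => hx0 (him r h)
    obtain ⟨s, t, ht, hst⟩ := hm.exists_inv hr'
    refine ⟨s, ?_⟩
    rw [← mul_smul]
    have := congrArg (fun z => z • i) hst
    simpa [add_smul, him t ht] using this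
  obtain ⟨U, -, hU⟩ := zorn_le_nonempty₀ P (by
    intro c hc hch y hy
    refine ⟨sSup c, ⟨?_, ?_⟩, fun z hz => le_sSup hz⟩
    · exact (le_sSup hy : y ≤ sSup c) (hc hy).1
    · intro x hx hx0
      obtain ⟨z, hz, hxz⟩ := (Submodule.mem_sSup_of_directed ⟨y, hy⟩ hch.directedOn).1 hx
      exact (hc hz).2 x hxz hx0) _ hP0
  obtain ⟨C, -, hC⟩ := zorn_le_nonempty₀ {C : Submodule R I | ∀ x ∈ C, x ∈ U → x = 0} (by
    intro c hc hch y hy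
    refine ⟨sSup c, ?_, fun z hz => le_sSup hz⟩
    intro x hx hxU
    obtain ⟨z, hz, hxz⟩ := (Submodule.mem_sSup_of_directed ⟨y, hy⟩ hch.directedOn).1 hx
    exact (hc hz) x hxz hxU) ⊥ (by intro x hx _; exact hx)
  have hinj : Function.Injective (C.mkQ.comp U.subtype) := by
    rw [injective_iff_map_eq_zero]
    intro x hx
    exact Subtype.ext (hC.prop x ((Submodule.Quotient.mk_eq_zero _).1 hx) x.2)
  obtain ⟨φ, hφ⟩ := hI.out (C.mkQ.comp U.subtype) hinj U.subtype
  have hφU : ∀ u ∈ U, φ (C.mkQ u) = u := fun u hu => hφ ⟨u, hu⟩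
  have hφinj : ∀ y, φ (C.mkQ y) = 0 → y ∈ C := by
    intro y hy
    have h1 : (LinearMap.ker φ).comap C.mkQ ∈ {C : Submodule R I | ∀ x ∈ C, x ∈ U → x = 0} := by
      intro x hx hxU
      have : φ (C.mkQ x) = 0 := hx
      rw [hφU x hxU] at this
      exact this
    have h2 : C ≤ (LinearMap.ker φ).comap C.mkQ := by
      intro x hx
      have : C.mkQ x = 0 := (Submodule.Quotient.mk_eq_zero _).2 hx
      change φ (C.mkQ x) = 0
      rw [this, map_zero]
    exact hC.le_of_ge h1 h2 hy
  have hV : LinearMap.range φ ∈ P := by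
    refine ⟨⟨C.mkQ i, hφU i hU.prop.1⟩, ?_⟩
    rintro _ ⟨y, rfl⟩ hy0
    obtain ⟨y, rfl⟩ := C.mkQ_surjective y
    have hyC : y ∉ C := by
      intro h
      apply hy0
      have : C.mkQ y = 0 := (Submodule.Quotient.mk_eq_zero _).2 h
      rw [this, map_zero]
    by_contra hcon
    push Not at hcon
    have h1 : C ⊔ Submodule.span R {y} ∈ {C : Submodule R I | ∀ x ∈ C, x ∈ U → x = 0} := by
      intro x hx hxU
      obtain ⟨c, hc, z, hz, rfl⟩ := Submodule.mem_sup.1 hx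
      obtain ⟨r, rfl⟩ := Submodule.mem_span_singleton.1 hz
      by_contra hne
      obtain ⟨s, hs⟩ := hU.prop.2 _ hxU hne
      apply hcon (s * r)
      have h3 := hφU _ hxU
      have hc0 : C.mkQ c = 0 := (Submodule.Quotient.mk_eq_zero _).2 hc
      rw [map_add, hc0, zero_add, map_smul, map_smul] at h3
      rw [mul_smul, h3, hs]
    exact hyC (hC.le_of_ge h1 le_sup_left (Submodule.mem_sup_right (Submodule.mem_span_singleton_self y)))
  have hUV : LinearMap.range φ ≤ U := hU.le_of_ge hV fun u hu => ⟨C.mkQ u, hφU u hu⟩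
  let ρ : I →ₗ[R] U := (φ.comp C.mkQ).codRestrict U fun x => hUV ⟨_, rfl⟩
  have hρ : ∀ u : U, ρ u = u := fun u => Subtype.ext (hφU u u.2)
  refine ⟨U, inferInstance, inferInstance, ?_, ?_, ⟨i, hU.prop.1⟩, ?_, ?_⟩
  · have := noeth_hom (R := R) (⟨i, hU.prop.1⟩ : U) (fun x hx => by
      obtain ⟨r, hr⟩ := hU.prop.2 x x.2 (fun h => hx (Subtype.ext h))
      exact ⟨r, Subtype.ext hr⟩) (fun h => hi (congrArg Subtype.val h)) R
    exact Module.Finite.equiv (LinearMap.ringLmapEquivSelf R R U)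
  · refine ⟨fun X Y _ _ _ _ f hf g => ?_⟩
    obtain ⟨h, hh⟩ := hI.out f hf (U.subtype.comp g)
    exact ⟨ρ.comp h, fun x => by rw [LinearMap.comp_apply, hh]; exact hρ (g x)⟩
  · exact fun h => hi (congrArg Subtype.val h)
  · exact fun r hr => Subtype.ext (him r hr)

end InjHull


section LAS

variable {R : Type} [CommRing R] [IsArtinianRing R] [Algebra R Λ]

lemma exists_theta (S : Type) [Ring S] [Algebra R S] [IsLocalRing S] :
    ∃ (E : Type) (_ : AddCommGroup E) (_ : Module R E), Module.Finite R E ∧ Module.Injective R E ∧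
      ∃ θ : S →ₗ[R] E, θ 1 ≠ 0 ∧ ∀ g, ¬ IsUnit g → θ g = 0 := by
  have hadd : ∀ a b : S, ¬ IsUnit a → ¬ IsUnit b → ¬ IsUnit (a + b) := by
    rintro a b ha hb ⟨u, hu⟩
    have h1 : (↑u⁻¹ * a : S) + ↑u⁻¹ * b = 1 := by rw [← mul_add, ← hu, Units.inv_mul]
    rcases IsLocalRing.isUnit_or_isUnit_of_add_one h1 with h | h
    · exact ha ((Units.isUnit_units_mul _ _).1 h)
    · exact hb ((Units.isUnit_units_mul _ _).1 h)
  let N : Submodule R S :=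
    { carrier := {g | ¬ IsUnit g}
      zero_mem' := not_isUnit_zero
      add_mem' := fun {a b} ha hb => hadd a b ha hb
      smul_mem' := fun r a ha h => ha (by
        rw [Algebra.smul_def,
          Commute.isUnit_mul_iff (show Commute (algebraMap R S r) a from Algebra.commutes r a)] at h
        exact h.2) }
  have hN1 : (1 : S) ∉ N := fun h => h isUnit_one
  let m : Ideal R := LinearMap.ker (N.mkQ.comp (Algebra.linearMap R S))
  have hmem : ∀ r, r ∈ m ↔ ¬ IsUnit (algebraMap R S r) := by
    intro r
    exact Submodule.Quotient.mk_eq_zero N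
  have hprime : m.IsPrime := by
    refine ⟨?_, ?_⟩
    · rw [Ne, Ideal.eq_top_iff_one, hmem, map_one]
      exact not_not.2 isUnit_one
    · intro a b hab
      by_contra hcon
      push Not at hcon
      rw [hmem, hmem, not_not, not_not] at hcon
      rw [hmem, map_mul] at hab
      exact hab (hcon.1.mul hcon.2)
  have hmax : m.IsMaximal := inferInstance
  obtain ⟨E, _, _, hE, hEi, e, he, hme⟩ := exists_fg_injective m
  refine ⟨E, inferInstance, inferInstance, hE, hEi, ?_⟩
  obtain ⟨θ, hθ⟩ := hEi.out (m.liftQ (N.mkQ.comp (Algebra.linearMap R S)) le_rfl)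
    (by
      rw [← LinearMap.ker_eq_bot]
      exact Submodule.ker_liftQ_eq_bot _ _ _ le_rfl)
    (m.liftQ (LinearMap.toSpanSingleton R E e) (fun r hr => hme r hr))
  refine ⟨θ.comp N.mkQ, ?_, fun g hg => ?_⟩
  · have := hθ (m.mkQ 1)
    simp only [Submodule.mkQ_apply, Submodule.liftQ_apply, LinearMap.comp_apply,
      Algebra.linearMap_apply, map_one] at this
    rw [LinearMap.comp_apply, Submodule.mkQ_apply, this]
    change (1 : R) • e ≠ 0
    rw [one_smul]
    exact he
  · have : N.mkQ g = 0 := (Submodule.Quotient.mk_eq_zero N).2 hg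
    rw [LinearMap.comp_apply, this, map_zero]

variable [Module.Finite R Λ]
variable {Z : Type} [AddCommGroup Z] [Module Λ Z] [Module R Z] [IsScalarTower R Λ Z]
  [Module.Finite Λ Z]

lemma exists_delta {E : Type} [AddCommGroup E] [Module R E] [Module.Finite R E]
    [hE : Module.Injective R E] (θ : (Z →ₗ[Λ] Z) →ₗ[R] E) :
    ∃ (K : ℕ) (δ : Fin K → (Z →ₗ[R] E)) (ζ : Fin K → Z), Submodule.span R (Set.range δ) = ⊤ ∧
      ∀ g, θ g = ∑ p, δ p (g (ζ p)) := by
  classical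
  have : Module.Finite R Z := Module.Finite.trans Λ Z
  have : Module.Finite R (Z →ₗ[R] E) := finite_hom (Λ := R) R Z E
  obtain ⟨K, δ, hδ⟩ := Module.Finite.exists_fin (R := R) (M := (Z →ₗ[R] E))
  obtain ⟨a, c, hc⟩ := Module.Finite.exists_fin (R := Λ) (M := Z)
  let ev : (Z →ₗ[Λ] Z) →ₗ[R] (Fin a → Z) :=
    { toFun := fun f i => f (c i)
      map_add' := fun _ _ => rfl
      map_smul' := fun _ _ => rfl }
  obtain ⟨Θ, hΘ⟩ := hE.out ev (fun f f' hff =>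
    LinearMap.ext_on_range hc fun i => congrFun hff i) θ
  have hr : ∀ i, ∃ r : Fin K → R, ∑ p, r p • δ p = Θ.comp (LinearMap.single R (fun _ => Z) i) := by
    intro i
    have : Θ.comp (LinearMap.single R (fun _ => Z) i) ∈ Submodule.span R (Set.range δ) := by
      rw [hδ]; trivial
    exact (Submodule.mem_span_range_iff_exists_fun R).1 this
  choose r hr using hr
  refine ⟨K, δ, fun p => ∑ i, r i p • c i, hδ, fun g => ?_⟩
  rw [← hΘ g]
  have h1 : ev g = ∑ i, Pi.single i (g (c i)) := by
    rw [Finset.univ_sum_single]; rfl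
  rw [h1, map_sum]
  have h2 : ∀ i, Θ (Pi.single i (g (c i))) = ∑ p, r i p • δ p (g (c i)) := by
    intro i
    have := congrArg (fun q => q (g (c i))) (hr i)
    simp only [LinearMap.sum_apply, LinearMap.smul_apply, LinearMap.comp_apply,
      LinearMap.coe_single] at this
    exact this.symm
  rw [Finset.sum_congr rfl fun i _ => h2 i, Finset.sum_comm]
  refine Finset.sum_congr rfl fun p _ => ?_
  rw [map_sum, map_sum]
  refine Finset.sum_congr rfl fun i _ => ?_
  rw [LinearMap.map_smul_of_tower, map_smul]

lemma exists_lambda {E : Type} [AddCommGroup E] [Module R E] {K : ℕ} (δ : Fin K → (Z →ₗ[R] E)) :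
    ∃ (Q : ℕ) (l : Fin Q → Fin K → Λ), (∀ q z, ∑ p, δ p (l q p • z) = 0) ∧
      ∀ μ : Fin K → Λ, (∀ z, ∑ p, δ p (μ p • z) = 0) → ∃ t : Fin Q → R, ∀ p, μ p = ∑ q, t q • l q p := by
  let L : Submodule R (Fin K → Λ) :=
    { carrier := {μ | ∀ z, ∑ p, δ p (μ p • z) = 0}
      zero_mem' := fun z => by simp
      add_mem' := fun {a b} ha hb z => by
        simp only [Pi.add_apply, add_smul, map_add, Finset.sum_add_distrib, ha z, hb z, add_zero]
      smul_mem' := fun r a ha z => by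
        simp only [Pi.smul_apply, smul_assoc, map_smul, ← Finset.smul_sum, ha z, smul_zero] }
  have : Module.Finite R L := inferInstance
  obtain ⟨Q, g, hg⟩ := Module.Finite.exists_fin (R := R) (M := L)
  refine ⟨Q, fun q => (g q : Fin K → Λ), fun q => (g q).2, fun μ hμ => ?_⟩
  have : (⟨μ, hμ⟩ : L) ∈ Submodule.span R (Set.range g) := by rw [hg]; trivial
  obtain ⟨t, ht⟩ := (Submodule.mem_span_range_iff_exists_fun R).1 this
  refine ⟨t, fun p => ?_⟩
  have := congrArg (fun x : L => (x : Fin K → Λ) p) ht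
  simp at this
  rw [← this]

lemma exists_w {E : Type} [AddCommGroup E] [Module R E]
    [hE : Module.Injective R E] {K : ℕ} (δ : Fin K → (Z →ₗ[R] E))
    (hδ : Submodule.span R (Set.range δ) = ⊤) {Q : ℕ} (l : Fin Q → Fin K → Λ)
    (hl : ∀ μ : Fin K → Λ, (∀ z, ∑ p, δ p (μ p • z) = 0) →
      ∃ t : Fin Q → R, ∀ p, μ p = ∑ q, t q • l q p)
    {Y : Type} [AddCommGroup Y] [Module Λ Y] [Module.Finite Λ Y] (y : Fin K → Y)
    (hy : ∀ h : Y →ₗ[Λ] Z, ∑ p, δ p (h (y p)) = 0) :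
    ∃ w : Fin Q → Y, ∀ p, y p = ∑ q, l q p • w q := by
  classical
  have hnoe : IsNoetherianRing Λ := noeth_of_artin R
  obtain ⟨a, π, hπ⟩ := Module.Finite.exists_fin' Λ Y
  have hkf : Module.Finite Λ (LinearMap.ker π) := inferInstance
  obtain ⟨b, ρ, hρ⟩ := Module.Finite.exists_fin (R := Λ) (M := LinearMap.ker π)
  choose μ hμ using fun p => hπ (y p)
  let A : (Fin a → Z) →ₗ[R] E :=
    ∑ p, (δ p).comp (∑ s, (Algebra.lsmul R R Z (μ p s)).comp (LinearMap.proj s))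
  let B : (Fin a → Z) →ₗ[R] (Fin b → Z) :=
    LinearMap.pi fun i => ∑ s, (Algebra.lsmul R R Z ((ρ i : Fin a → Λ) s)).comp (LinearMap.proj s)
  have hA : ∀ v, A v = ∑ p, δ p (∑ s, μ p s • v s) := fun v => by
    simp [A, LinearMap.sum_apply]
  have hB : ∀ v i, B v i = ∑ s, (ρ i : Fin a → Λ) s • v s := fun v i => by
    simp [B, LinearMap.sum_apply]
  have hker : LinearMap.ker B ≤ LinearMap.ker A := by
    intro v hv
    let h0 : (Fin a → Λ) →ₗ[Λ] Z := ∑ s, (LinearMap.toSpanSingleton Λ Z (v s)).comp (LinearMap.proj s)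
    have hh0 : ∀ x, h0 x = ∑ s, x s • v s := fun x => by simp [h0, LinearMap.sum_apply]
    have hk : LinearMap.ker π ≤ LinearMap.ker h0 := by
      have h1 : (⊤ : Submodule Λ (LinearMap.ker π)) ≤
          LinearMap.ker (h0.comp (LinearMap.ker π).subtype) := by
        rw [← hρ, Submodule.span_le]
        rintro _ ⟨i, rfl⟩
        have := hB v i
        rw [LinearMap.mem_ker.1 hv] at this
        change h0 (ρ i) = 0
        rw [hh0, ← this]
        rfl
      intro x hx
      exact h1 (x := ⟨x, hx⟩) trivial
    let h : Y →ₗ[Λ] Z := ((LinearMap.ker π).liftQ h0 hk).comp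
      (π.quotKerEquivOfSurjective hπ).symm.toLinearMap
    have hh : ∀ x, h (π x) = h0 x := by
      intro x
      have he : (π.quotKerEquivOfSurjective hπ).symm (π x) = (LinearMap.ker π).mkQ x := by
        rw [LinearEquiv.symm_apply_eq]; rfl
      simp only [h, LinearMap.comp_apply, LinearEquiv.coe_coe]
      rw [he]
      rfl
    have := hy h
    rw [LinearMap.mem_ker, hA, ← this]
    refine Finset.sum_congr rfl fun p _ => ?_
    rw [← hμ p, hh, hh0]
  obtain ⟨G, hG⟩ := hE.out ((LinearMap.ker B).liftQ B le_rfl)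
    (by
      rw [← LinearMap.ker_eq_bot]
      exact Submodule.ker_liftQ_eq_bot _ _ _ le_rfl)
    ((LinearMap.ker B).liftQ A hker)
  have hG' : ∀ v, G (B v) = A v := fun v => hG ((LinearMap.ker B).mkQ v)
  have hr : ∀ i, ∃ r : Fin K → R, ∑ p, r p • δ p = G.comp (LinearMap.single R (fun _ => Z) i) := by
    intro i
    have : G.comp (LinearMap.single R (fun _ => Z) i) ∈ Submodule.span R (Set.range δ) := by
      rw [hδ]; trivial
    exact (Submodule.mem_span_range_iff_exists_fun R).1 this
  choose r hr using hr
  have hG2 : ∀ z, G z = ∑ i, ∑ p, r i p • δ p (z i) := by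
    intro z
    conv_lhs => rw [← Finset.univ_sum_single z]
    rw [map_sum]
    refine Finset.sum_congr rfl fun i _ => ?_
    have := congrArg (fun q => q (z i)) (hr i)
    simp only [LinearMap.sum_apply, LinearMap.smul_apply, LinearMap.comp_apply,
      LinearMap.coe_single] at this
    exact this.symm
  have hL : ∀ s z, ∑ p, δ p ((μ p s - ∑ i, r i p • (ρ i : Fin a → Λ) s) • z) = 0 := by
    intro s z
    have h1 := hG' (Pi.single s z)
    have h2 : ∀ x : Fin a → Λ, ∑ t, x t • (Pi.single s z : Fin a → Z) t = x s • z := by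
      intro x
      rw [Finset.sum_eq_single s]
      · simp
      · intro t _ ht; simp [Pi.single_eq_of_ne ht]
      · simp
    rw [hA, hG2] at h1
    simp only [hB, h2] at h1
    simp only [sub_smul, map_sub, Finset.sum_sub_distrib]
    rw [← h1, sub_eq_zero, Finset.sum_comm]
    refine Finset.sum_congr rfl fun p _ => ?_
    rw [Finset.sum_smul, map_sum]
    refine Finset.sum_congr rfl fun i _ => ?_
    rw [smul_assoc]
    exact ((δ p).map_smul (r i p) _).symm
  choose t ht using fun s => hl _ (hL s)
  let c : Fin a → Y := fun s => π (Pi.single s 1)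
  have hπc : ∀ x, π x = ∑ s, x s • c s := by
    intro x
    conv_lhs => rw [← Finset.univ_sum_single x]
    rw [map_sum]
    refine Finset.sum_congr rfl fun s _ => ?_
    rw [← map_smul, ← Pi.single_smul, smul_eq_mul, mul_one]
  refine ⟨fun q => ∑ s, algebraMap R Λ (t s q) • c s, fun p => ?_⟩
  have h3 : y p = ∑ s, (μ p s - ∑ i, r i p • (ρ i : Fin a → Λ) s) • c s := by
    simp only [sub_smul, Finset.sum_sub_distrib]
    rw [← hπc, hμ]
    have h4 : ∑ s, (∑ i, r i p • (ρ i : Fin a → Λ) s) • c s = 0 := by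
      have h5 : π (∑ i, algebraMap R Λ (r i p) • (ρ i : Fin a → Λ)) = 0 := by
        rw [map_sum]
        refine Finset.sum_eq_zero fun i _ => ?_
        rw [map_smul, LinearMap.mem_ker.1 (ρ i).2, smul_zero]
      rw [hπc] at h5
      rw [← h5]
      refine Finset.sum_congr rfl fun s _ => ?_
      simp [Finset.sum_apply, Algebra.smul_def]
    rw [h4, sub_zero]
  rw [h3]
  simp only [Finset.smul_sum]
  rw [Finset.sum_comm]
  refine Finset.sum_congr rfl fun s _ => ?_
  rw [ht s p, Finset.sum_smul]
  refine Finset.sum_congr rfl fun q _ => ?_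
  rw [Algebra.smul_def, ← mul_smul, Algebra.commutes]

end LAS


section LAS2

lemma exists_las (R : Type) [CommRing R] [IsArtinianRing R] [Algebra R Λ] [Module.Finite R Λ]
    (Z : Type) [AddCommGroup Z] [Module Λ Z] [Module.Finite Λ Z] [IsLocalRing (Module.End Λ Z)] :
    ∃ (W : Type) (_ : AddCommGroup W) (_ : Module Λ W) (_ : Module.Finite Λ W) (j : Z →ₗ[Λ] W),
      (∀ r : W →ₗ[Λ] Z, r ∘ₗ j ≠ LinearMap.id) ∧
      ∀ (Y : Type) [AddCommGroup Y] [Module Λ Y] [Module.Finite Λ Y] (f : Z →ₗ[Λ] Y),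
        (∀ h : Y →ₗ[Λ] Z, h ∘ₗ f ≠ LinearMap.id) → ∃ g : W →ₗ[Λ] Y, g ∘ₗ j = f := by
  classical
  let _ : Module R Z := Module.compHom Z (algebraMap R Λ)
  have : IsScalarTower R Λ Z := ⟨fun r l m => by rw [Algebra.smul_def, mul_smul]; rfl⟩
  obtain ⟨E, _, _, hE, hEi, θ, hθ1, hθ⟩ := exists_theta (R := R) (Module.End Λ Z)
  obtain ⟨K, δ, ζ, hδ, hθζ⟩ := exists_delta (R := R) (Λ := Λ) (Z := Z) θ
  obtain ⟨Q, l, hl0, hl⟩ := exists_lambda (R := R) (Λ := Λ) (Z := Z) δ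
  let S : Submodule Λ (Z × (Fin Q → Λ)) :=
    Submodule.span Λ (Set.range fun p => (ζ p, - fun q => l q p))
  refine ⟨(Z × (Fin Q → Λ)) ⧸ S, inferInstance, inferInstance, inferInstance,
    S.mkQ ∘ₗ LinearMap.inl Λ Z (Fin Q → Λ), ?_, ?_⟩
  · intro r hr
    apply hθ1
    let w : Fin Q → Z := fun q => r (S.mkQ (0, Pi.single q 1))
    have hw : ∀ u : Fin Q → Λ, r (S.mkQ (0, u)) = ∑ q, u q • w q := by
      intro u
      let φ : (Fin Q → Λ) →ₗ[Λ] Z := r ∘ₗ S.mkQ ∘ₗ LinearMap.inr Λ Z (Fin Q → Λ)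
      change φ u = ∑ q, u q • φ (Pi.single q 1)
      conv_lhs => rw [← Finset.univ_sum_single u]
      rw [map_sum]
      refine Finset.sum_congr rfl fun s _ => ?_
      rw [← map_smul, ← Pi.single_smul, smul_eq_mul, mul_one]
    have hz : ∀ p, ζ p = ∑ q, l q p • w q := by
      intro p
      have h1 : r (S.mkQ (ζ p, 0)) = ζ p := LinearMap.congr_fun hr (ζ p)
      rw [← hw (fun q => l q p), ← h1]
      congr 1
      rw [← sub_eq_zero, ← map_sub]
      refine (Submodule.Quotient.mk_eq_zero S).2 ?_
      refine Submodule.subset_span ⟨p, ?_⟩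
      simp
    rw [hθζ]
    change ∑ p, δ p (ζ p) = 0
    rw [Finset.sum_congr rfl fun p _ => congrArg (δ p) (hz p)]
    simp only [map_sum]
    rw [Finset.sum_comm]
    exact Finset.sum_eq_zero fun q _ => hl0 q _
  · intro Y _ _ _ f hf
    obtain ⟨w, hw⟩ := exists_w δ hδ l hl (fun p => f (ζ p)) (fun h => by
      have h1 : ¬ IsUnit ((h ∘ₗ f : Module.End Λ Z)) := by
        rintro ⟨u, hu⟩
        apply hf ((↑u⁻¹ : Module.End Λ Z) ∘ₗ h)
        rw [LinearMap.comp_assoc, ← hu]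
        exact u.inv_mul
      have := hθ _ h1
      rw [hθζ] at this
      exact this)
    let φ : (Fin Q → Λ) →ₗ[Λ] Y := ∑ q, (LinearMap.toSpanSingleton Λ Y (w q)).comp (LinearMap.proj q)
    have hφ : ∀ u, φ u = ∑ q, u q • w q := fun u => by simp [φ, LinearMap.sum_apply]
    refine ⟨S.liftQ (f.coprod φ) ?_, ?_⟩
    · rw [Submodule.span_le]
      rintro _ ⟨p, rfl⟩
      change f.coprod φ (ζ p, - fun q => l q p) = 0
      rw [LinearMap.coprod_apply, map_neg, hφ, ← sub_eq_add_neg, sub_eq_zero]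
      exact hw p
    · ext z
      change f.coprod φ (z, 0) = f z
      simp

/-- a left almost split map inside an n-cluster tilting subcategory -/
lemma CT.las (R : Type) [CommRing R] [IsArtinianRing R] [Algebra R Λ] [Module.Finite R Λ]
    {n : ℕ} {𝔪 : Set (ModuleCat.{0} Λ)} (h : IsNClusterTilting n (modFG Λ) 𝔪)
    (Z : ModuleCat.{0} Λ) [Module.Finite Λ Z] [IsLocalRing (Module.End Λ Z)] :
    ∃ B ∈ 𝔪, ∃ j : Z →ₗ[Λ] B, (∀ r : B →ₗ[Λ] Z, r ∘ₗ j ≠ LinearMap.id) ∧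
      ∀ Y ∈ 𝔪, ∀ f : Z →ₗ[Λ] Y,
        (∀ h : Y →ₗ[Λ] Z, h ∘ₗ f ≠ LinearMap.id) → ∃ g : B →ₗ[Λ] Y, g ∘ₗ j = f := by
  obtain ⟨W, _, _, hW, j, hj, hu⟩ := exists_las R (Λ := Λ) Z
  obtain ⟨B, hB, f, -, hf⟩ := CT.left_approx h (ModuleCat.of Λ W) hW
  refine ⟨B, hB, f.hom ∘ₗ j, fun r hr => hj (r ∘ₗ f.hom) hr, fun Y hY g hg => ?_⟩
  have : Module.Finite Λ Y := CT.fg h hY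
  obtain ⟨k, hk⟩ := hu Y g hg
  obtain ⟨k', hk'⟩ := hf Y hY (ModuleCat.ofHom k)
  refine ⟨k'.hom, ?_⟩
  rw [← hk]
  have : k'.hom ∘ₗ f.hom = k := congrArg ModuleCat.Hom.hom hk'
  rw [← this]
  rfl

end LAS2


section Decomposition

/-- Finite decompositions into modules with local endomorphism rings. -/
def Decomp (M : ModuleCat.{0} Λ) : Prop :=
  ∃ (ι : Type) (_ : Fintype ι) (Z : ι → ModuleCat.{0} Λ) (s : ∀ j, Z j →ₗ[Λ] M)
    (r : ∀ j, M →ₗ[Λ] Z j), (∀ j, IsLocalRing (Module.End Λ (Z j))) ∧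
    (∀ j, r j ∘ₗ s j = LinearMap.id) ∧ ∀ x, ∑ j, s j (r j x) = x

lemma Decomp.of_isCompl {M : Type} [AddCommGroup M] [Module Λ M] {p q : Submodule Λ M}
    (hpq : IsCompl p q) (hp : Decomp (ModuleCat.of Λ p)) (hq : Decomp (ModuleCat.of Λ q)) :
    Decomp (ModuleCat.of Λ M) := by
  obtain ⟨ι, _, Z, s, r, hZ, hrs, hs⟩ := hp
  obtain ⟨ι', _, Z', s', r', hZ', hrs', hs'⟩ := hq
  refine ⟨ι ⊕ ι', inferInstance, Sum.elim Z Z',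
    fun j => match j with
      | .inl j => p.subtype ∘ₗ s j
      | .inr j => q.subtype ∘ₗ s' j,
    fun j => match j with
      | .inl j => r j ∘ₗ p.projectionOnto q hpq
      | .inr j => r' j ∘ₗ q.projectionOnto p hpq.symm, ?_, ?_, ?_⟩
  · rintro (j | j)
    · exact hZ j
    · exact hZ' j
  · rintro (j | j)
    · ext x
      have h1 := LinearMap.congr_fun (hrs j) x
      have h2 : p.projectionOnto q hpq (s j x : p) = s j x :=
        Submodule.projectionOnto_apply_left hpq (s j x : p)
      change r j (p.projectionOnto q hpq (s j x : p)) = x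
      rw [h2]
      exact h1
    · ext x
      have h1 := LinearMap.congr_fun (hrs' j) x
      have h2 : q.projectionOnto p hpq.symm (s' j x : q) = s' j x :=
        Submodule.projectionOnto_apply_left hpq.symm (s' j x : q)
      change r' j (q.projectionOnto p hpq.symm (s' j x : q)) = x
      rw [h2]
      exact h1
  · intro x
    rw [Fintype.sum_sum_type]
    change ∑ j, p.subtype (s j (r j (p.projectionOnto q hpq x))) +
      ∑ j, q.subtype (s' j (r' j (q.projectionOnto p hpq.symm x))) = x
    have e1 := congrArg p.subtype (hs (p.projectionOnto q hpq x))
    have e2 := congrArg q.subtype (hs' (q.projectionOnto p hpq.symm x))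
    rw [map_sum] at e1 e2
    refine (congrArg₂ (· + ·) e1 e2).trans ?_
    obtain ⟨a, ha, b, hb, rfl⟩ : ∃ a ∈ p, ∃ b ∈ q, a + b = x :=
      Submodule.mem_sup.1 (hpq.sup_eq_top ▸ Submodule.mem_top)
    change (p.projectionOnto q hpq (a + b) : M) + (q.projectionOnto p hpq.symm (a + b) : M) = a + b
    rw [map_add, map_add, Submodule.projectionOnto_apply_of_mem_left hpq ha,
      Submodule.projectionOnto_apply_of_mem_right hpq hb,
      Submodule.projectionOnto_apply_of_mem_left hpq.symm hb,
      Submodule.projectionOnto_apply_of_mem_right hpq.symm ha]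
    simp

lemma decomp_aux [IsArtinianRing Λ] [IsNoetherianRing Λ] (n : ℕ) :
    ∀ (M : Type) [AddCommGroup M] [Module Λ M] [Module.Finite Λ M], Module.length Λ M < n →
      Decomp (ModuleCat.of Λ M) := by
  induction n with
  | zero => intro M _ _ _ h; simp at h
  | succ n ih =>
    intro M _ _ _ hlen
    rcases subsingleton_or_nontrivial M with hM | hM
    · exact ⟨Empty, inferInstance, fun _ => ModuleCat.of Λ M, fun _ => 0, fun _ => 0,
        fun j => j.elim, fun j => j.elim, fun x => Subsingleton.elim (α := M) _ _⟩
    by_cases hloc : IsLocalRing (Module.End Λ M)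
    · exact ⟨Unit, inferInstance, fun _ => ModuleCat.of Λ M, fun _ => LinearMap.id,
        fun _ => LinearMap.id, fun _ => hloc, fun _ => rfl, fun x => by simp⟩
    obtain ⟨a, ha, ha1⟩ : ∃ a : Module.End Λ M, ¬ IsUnit a ∧ ¬ IsUnit (1 - a) := by
      by_contra hcon
      push Not at hcon
      apply hloc
      refine ⟨fun {a b} hab => ?_⟩
      by_cases h : IsUnit a
      · exact Or.inl h
      · right
        rw [eq_sub_of_add_eq' hab]
        exact hcon a h
    obtain ⟨N, hN⟩ := Filter.eventually_atTop.1 (LinearMap.eventually_isCompl_ker_pow_range_pow a)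
    have hc := hN (N + 1) (by omega)
    have hk1 : LinearMap.ker (a ^ (N+1)) ≠ ⊤ := by
      intro h
      apply ha1
      have : a ^ (N+1) = 0 := LinearMap.ker_eq_top.1 h
      exact IsNilpotent.isUnit_one_sub ⟨N+1, this⟩
    have hk2 : LinearMap.range (a ^ (N+1)) ≠ ⊤ := by
      intro h
      have h0 : LinearMap.ker (a ^ (N+1)) = ⊥ := by
        have := hc.inf_eq_bot
        rwa [h, inf_top_eq] at this
      have hu : IsUnit (a ^ (N+1)) := (Module.End.isUnit_iff _).2
        ⟨LinearMap.ker_eq_bot.1 h0, LinearMap.range_eq_top.1 h⟩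
      exact ha ((isUnit_pow_succ_iff).1 hu)
    have key : ∀ p : Submodule Λ M, p ≠ ⊤ → Module.length Λ p < n := by
      intro p hp
      have h1 := Submodule.length_lt hp
      have h2 : Module.length Λ M ≤ n := Order.le_of_lt_add_one (by exact_mod_cast hlen)
      exact lt_of_lt_of_le h1 h2
    exact Decomp.of_isCompl hc (ih _ (key _ hk1)) (ih _ (key _ hk2))

lemma exists_decomp (R : Type) [CommRing R] [IsArtinianRing R] [Algebra R Λ] [Module.Finite R Λ]
    (M : ModuleCat.{0} Λ) (hM : Module.Finite Λ M) : Decomp M := by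
  have := noeth_of_artin (Λ := Λ) R
  have := artin_of_artin (Λ := Λ) R
  have h := Module.length_ne_top (R := Λ) (M := M)
  obtain ⟨k, hk⟩ := ENat.ne_top_iff_exists.1 h
  exact decomp_aux (k+1) M (by rw [← hk]; exact_mod_cast Nat.lt_succ_self k)

end Decomposition


section Limit

variable (Z : ℕ → Type) [∀ j, AddCommGroup (Z j)] [∀ j, Module Λ (Z j)]
  (g : ∀ j, Z j →ₗ[Λ] Z (j+1))

/-- transition maps -/
noncomputable def tr (i j : ℕ) (hij : i ≤ j) : Z i →ₗ[Λ] Z j :=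
  Nat.leRec (motive := fun j _ => Z i →ₗ[Λ] Z j) LinearMap.id (fun k _ φ => g k ∘ₗ φ) hij

lemma tr_self (i : ℕ) (h : i ≤ i) : tr Z g i i h = LinearMap.id := Nat.leRec_self _ _

lemma tr_succ (i j : ℕ) (h : i ≤ j) : tr Z g i (j+1) (by omega) = g j ∘ₗ tr Z g i j h :=
  Nat.leRec_succ _ _ h

lemma tr_trans (i j k : ℕ) (hij : i ≤ j) (hjk : j ≤ k) (x : Z i) :
    tr Z g j k hjk (tr Z g i j hij x) = tr Z g i k (hij.trans hjk) x := by
  induction k, hjk using Nat.le_induction with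
  | base => rw [tr_self]; rfl
  | succ k hjk ih =>
    rw [tr_succ Z g j k hjk, tr_succ Z g i k (hij.trans hjk), LinearMap.comp_apply, ih]
    rfl

instance tr_directed : DirectedSystem Z (fun i j h => tr Z g i j h) where
  map_self i x := by rw [tr_self]; rfl
  map_map i j k hij hjk x := tr_trans Z g _ _ _ _ _ x

lemma of_zero_exact {i : ℕ} {x : Z i}
    (h : Module.DirectLimit.of Λ ℕ Z (tr Z g) i x = 0) : ∃ j, ∃ hij : i ≤ j, tr Z g i j hij x = 0 :=
  Module.DirectLimit.of.zero_exact h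

lemma of_zero_family {a : ℕ} {i : ℕ} (x : Fin a → Z i)
    (h : ∀ s, Module.DirectLimit.of Λ ℕ Z (tr Z g) i (x s) = 0) :
    ∃ j, ∃ hij : i ≤ j, ∀ s, tr Z g i j hij (x s) = 0 := by
  choose J hJ hJ0 using fun s => of_zero_exact Z g (h s)
  refine ⟨i + ∑ s, J s, by omega, fun s => ?_⟩
  have hs : J s ≤ i + ∑ s, J s :=
    (Finset.single_le_sum (f := J) (fun _ _ => Nat.zero_le _) (Finset.mem_univ s)).trans (by omega)
  rw [← tr_trans Z g i (J s) _ (hJ s) hs, hJ0, map_zero]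

lemma of_family {a : ℕ} (x : Fin a → Module.DirectLimit Z (tr Z g)) :
    ∃ j, ∃ y : Fin a → Z j, ∀ s, Module.DirectLimit.of Λ ℕ Z (tr Z g) j (y s) = x s := by
  choose J y hy using fun s => Module.DirectLimit.exists_of (x s)
  have hs : ∀ s, J s ≤ ∑ s, J s := fun s =>
    (Finset.single_le_sum (f := J) (fun _ _ => Nat.zero_le _) (Finset.mem_univ s))
  refine ⟨∑ s, J s, fun s => tr Z g (J s) _ (hs s) (y s), fun s => ?_⟩
  rw [Module.DirectLimit.of_f, hy]

lemma lim_factor [IsNoetherianRing Λ] (F : Type) [AddCommGroup F] [Module Λ F] [Module.Finite Λ F]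
    (u : F →ₗ[Λ] Module.DirectLimit Z (tr Z g)) :
    ∃ m, ∃ v : F →ₗ[Λ] Z m, Module.DirectLimit.of Λ ℕ Z (tr Z g) m ∘ₗ v = u := by
  classical
  obtain ⟨a, π, hπ⟩ := Module.Finite.exists_fin' Λ F
  have hkf : Module.Finite Λ (LinearMap.ker π) := inferInstance
  obtain ⟨b, ρ, hρ⟩ := Module.Finite.exists_fin (R := Λ) (M := LinearMap.ker π)
  obtain ⟨m, y, hy⟩ := of_family Z g (fun s => u (π (Pi.single s 1)))
  let φ : (Fin a → Λ) →ₗ[Λ] Z m := ∑ s, (LinearMap.toSpanSingleton Λ (Z m) (y s)).comp (LinearMap.proj s)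
  have hφ : Module.DirectLimit.of Λ ℕ Z (tr Z g) m ∘ₗ φ = u ∘ₗ π := by
    refine LinearMap.pi_ext' fun s => LinearMap.ext_ring ?_
    have h1 : φ (Pi.single s 1) = y s := by
      simp only [φ, LinearMap.sum_apply, LinearMap.comp_apply, LinearMap.proj_apply,
        LinearMap.toSpanSingleton_apply]
      rw [Finset.sum_eq_single s]
      · simp
      · intro t _ ht; simp [Pi.single_eq_of_ne ht]
      · simp
    change Module.DirectLimit.of Λ ℕ Z (tr Z g) m (φ (Pi.single s 1)) = u (π (Pi.single s 1))
    rw [h1, hy]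
  obtain ⟨m', hm, h0⟩ := of_zero_family Z g (fun i => φ (ρ i)) (fun i => by
    have := LinearMap.congr_fun hφ (ρ i)
    simp only [LinearMap.comp_apply] at this
    rw [this, LinearMap.mem_ker.1 (ρ i).2, map_zero])
  let φ' := tr Z g m m' hm ∘ₗ φ
  have hk : LinearMap.ker π ≤ LinearMap.ker φ' := by
    have h1 : (⊤ : Submodule Λ (LinearMap.ker π)) ≤
        LinearMap.ker (φ'.comp (LinearMap.ker π).subtype) := by
      rw [← hρ, Submodule.span_le]
      rintro _ ⟨i, rfl⟩
      exact h0 i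
    intro x hx
    exact h1 (x := ⟨x, hx⟩) trivial
  let v : F →ₗ[Λ] Z m' := ((LinearMap.ker π).liftQ φ' hk).comp
    (π.quotKerEquivOfSurjective hπ).symm.toLinearMap
  have hv : ∀ x, v (π x) = φ' x := by
    intro x
    have he : (π.quotKerEquivOfSurjective hπ).symm (π x) = (LinearMap.ker π).mkQ x := by
      rw [LinearEquiv.symm_apply_eq]; rfl
    simp only [v, LinearMap.comp_apply, LinearEquiv.coe_coe]
    rw [he]
    rfl
  refine ⟨m', v, ?_⟩
  ext x
  obtain ⟨x, rfl⟩ := hπ x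
  rw [LinearMap.comp_apply, hv]
  change Module.DirectLimit.of Λ ℕ Z (tr Z g) m' (tr Z g m m' hm (φ x)) = _
  rw [Module.DirectLimit.of_f]
  exact LinearMap.congr_fun hφ x

end Limit

lemma nonunit_sum {S : Type} [Ring S] [IsLocalRing S] {ι : Type} (t : Finset ι) (f : ι → S)
    (hf : ∀ i ∈ t, ¬ IsUnit (f i)) : ¬ IsUnit (∑ i ∈ t, f i) := by
  classical
  induction t using Finset.induction_on with
  | empty => simp
  | insert a t ha ih =>
    rw [Finset.sum_insert ha]
    rintro ⟨u, hu⟩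
    have h1 : (↑u⁻¹ * f a : S) + ↑u⁻¹ * ∑ i ∈ t, f i = 1 := by
      rw [← mul_add, ← hu, Units.inv_mul]
    rcases IsLocalRing.isUnit_or_isUnit_of_add_one h1 with h | h
    · exact hf a (Finset.mem_insert_self _ _) ((Units.isUnit_units_mul _ _).1 h)
    · exact ih (fun i hi => hf i (Finset.mem_insert_of_mem hi)) ((Units.isUnit_units_mul _ _).1 h)

/-- If `α ∘ β` is a unit and both endomorphism rings are local then `α` is a split mono. -/
lemma split_of_unit {X Y : Type} [AddCommGroup X] [Module Λ X] [AddCommGroup Y] [Module Λ Y]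
    [IsLocalRing (Module.End Λ X)] [IsLocalRing (Module.End Λ Y)] (α : X →ₗ[Λ] Y) (β : Y →ₗ[Λ] X)
    (hu : IsUnit (α ∘ₗ β : Module.End Λ Y)) : ∃ γ : Y →ₗ[Λ] X, γ ∘ₗ α = LinearMap.id := by
  obtain ⟨u, hu⟩ := hu
  let γ : Y →ₗ[Λ] X := β ∘ₗ (↑u⁻¹ : Module.End Λ Y)
  have hγ : α ∘ₗ γ = LinearMap.id := by
    change (α ∘ₗ β) ∘ₗ (↑u⁻¹ : Module.End Λ Y) = _
    rw [← hu]
    exact u.mul_inv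
  let e : Module.End Λ X := γ ∘ₗ α
  have he : e * e = e := by
    change γ ∘ₗ (α ∘ₗ γ) ∘ₗ α = γ ∘ₗ α
    rw [hγ]; rfl
  refine ⟨γ, ?_⟩
  change e = 1
  rcases IsLocalRing.isUnit_or_isUnit_of_add_one (a := e) (b := 1 - e) (by abel) with h | h
  · have := h.mul_left_cancel (he.trans (mul_one e).symm)
    exact this
  · exfalso
    have h0 : (1 - e) * e = (1 - e) * 0 := by rw [sub_mul, he, one_mul, sub_self, mul_zero]
    have h1 : e = 0 := h.mul_left_cancel h0
    have h2 : (1 : Module.End Λ Y) = 0 := by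
      calc (1 : Module.End Λ Y) = (α ∘ₗ γ) ∘ₗ (α ∘ₗ γ) := by rw [hγ]; rfl
        _ = α ∘ₗ (e : X →ₗ[Λ] X) ∘ₗ γ := rfl
        _ = 0 := by rw [h1]; simp
    exact one_ne_zero h2


section Forward

variable {n : ℕ} {𝔪 : Set (ModuleCat.{0} Λ)}

lemma add_of_loc [IsNoetherianRing Λ] (h : IsNClusterTilting n (modFG Λ) 𝔪)
    (H : IsNClusterTilting n Set.univ (AddCl 𝔪)) {X : ModuleCat.{0} Λ} (hX : Loc 𝔪 X) :
    X ∈ AddCl 𝔪 := by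
  refine (H.char_right X trivial).2 fun i hi hin N hN => (extZero_iff' hi _ _).2 ?_
  obtain ⟨p, rfl⟩ : ∃ p, i = p + 1 := ⟨i - 1, by omega⟩
  exact EV.of_add hN fun M hM =>
    perp_of_loc hX p M (CT.fg h hM) fun M' hM' => CT.ev h hi hin hM hM'

lemma tnil [IsNoetherianRing Λ] (h : IsNClusterTilting n (modFG Λ) 𝔪)
    (H : IsNClusterTilting n Set.univ (AddCl 𝔪)) (Z : ℕ → ModuleCat.{0} Λ) (hZ : ∀ j, Z j ∈ 𝔪)
    (hloc : ∀ j, IsLocalRing (Module.End Λ (Z j))) (g : ∀ j, Z j →ₗ[Λ] Z (j+1))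
    (hg : ∀ j (r : Z (j+1) →ₗ[Λ] Z j), r ∘ₗ g j ≠ LinearMap.id) (w : ∀ j, Z j)
    (hw : ∀ j, w (j+1) = g j (w j)) : ∃ j, w j = 0 := by
  classical
  let T : ∀ i j : ℕ, i ≤ j → (Z i →ₗ[Λ] Z j) := tr (fun j => Z j) g
  have hT : ∀ i j k (hij : i ≤ j) (hjk : j ≤ k) x, T j k hjk (T i j hij x) = T i k (hij.trans hjk) x :=
    fun i j k hij hjk x => tr_trans (fun j => Z j) g i j k hij hjk x
  have hT1 : ∀ j, T j (j+1) (by omega) = g j := by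
    intro j
    have := tr_succ (fun j => Z j) g j j le_rfl
    rw [tr_self] at this
    exact this
  have hTw : ∀ m, T 0 m (Nat.zero_le m) (w 0) = w m := by
    intro m
    induction m with
    | zero => exact LinearMap.congr_fun (tr_self (fun j => Z j) g 0 le_rfl) (w 0)
    | succ m ih =>
      have := LinearMap.congr_fun (tr_succ (fun j => Z j) g 0 m (Nat.zero_le m)) (w 0)
      rw [hw m, ← ih]
      exact this
  let D := Module.DirectLimit (fun j => Z j) (tr (fun j => Z j) g)
  let X : ModuleCat.{0} Λ := ModuleCat.of Λ D
  let o : ∀ m, Z m →ₗ[Λ] D := fun m => Module.DirectLimit.of Λ ℕ (fun j => Z j) (tr (fun j => Z j) g) m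
  have ho : ∀ i j hij x, o j (T i j hij x) = o i x := fun i j hij x => Module.DirectLimit.of_f
  have hX : Loc 𝔪 X := by
    intro F hF u
    obtain ⟨m, v, hv⟩ := lim_factor (fun j => Z j) g F u.hom
    refine ⟨Z m, hZ m, ModuleCat.ofHom v, ModuleCat.ofHom (o m), ?_⟩
    ext x
    exact LinearMap.congr_fun hv x
  have hXa := add_of_loc h H hX
  let p : (⨁ j, Z j) →ₗ[Λ] D := DirectSum.toModule Λ ℕ D o
  obtain ⟨s, hs⟩ := lift_of_add hXa (ModuleCat.ofHom p : ModuleCat.of Λ (⨁ j, Z j) ⟶ X)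
    (fun M hM u => by
      have := CT.fg h hM
      obtain ⟨m, v, hv⟩ := lim_factor (fun j => Z j) g M u.hom
      refine ⟨ModuleCat.ofHom (DirectSum.lof Λ ℕ (fun j => Z j) m ∘ₗ v), ?_⟩
      ext x
      refine Eq.trans ?_ (LinearMap.congr_fun hv x)
      change p (DirectSum.lof Λ ℕ (fun j => Z j) m (v x)) = _
      exact DirectSum.toModule_lof Λ _ _) (𝟙 X)
  let s' : D →ₗ[Λ] ⨁ j, Z j := s.hom
  have hs' : ∀ x, p (s' x) = x := fun x => congrArg (fun q => q.hom x) hs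
  let a : ∀ j, D →ₗ[Λ] Z j := fun j => DirectSum.component Λ ℕ (fun j => Z j) j ∘ₗ s'
  -- expand the identity
  have hex : ∃ N, ∀ x, x = o 0 (w 0) → x = ∑ j ∈ Finset.range N, o j (a j x) := by
    let ξ : ⨁ j, Z j := s' (o 0 (w 0))
    refine ⟨(DFinsupp.support ξ).sup id + 1, ?_⟩
    rintro x rfl
    conv_lhs => rw [← hs' (o 0 (w 0))]
    change p ξ = _
    have hξ : ξ = ∑ j ∈ Finset.range ((DFinsupp.support ξ).sup id + 1),
        DirectSum.lof Λ ℕ (fun j => Z j) j (ξ j) := by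
      conv_lhs => rw [← DirectSum.sum_support_of ξ]
      refine Finset.sum_subset ?_ ?_
      · intro j hj
        exact Finset.mem_range.2 (Nat.lt_succ_of_le (Finset.le_sup (f := id) hj))
      · intro j _ hj
        have : ξ j = 0 := DFinsupp.notMem_support_iff.1 hj
        rw [this, map_zero]
    conv_lhs => rw [hξ]
    rw [map_sum]
    refine Finset.sum_congr rfl fun j _ => ?_
    exact DirectSum.toModule_lof Λ _ _
  obtain ⟨N, hN⟩ := hex
  have hN := hN _ rfl
  let c : ℕ → Z N := fun j => if hj : j ≤ N then T j N hj (a j (o 0 (w 0))) else 0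
  have hc : ∀ j ∈ Finset.range N, o N (c j) = o j (a j (o 0 (w 0))) := by
    intro j hj
    have hj := (Finset.mem_range.1 hj).le
    simp only [c, dif_pos hj]
    exact ho _ _ _ _
  have h0 : o N (w N - ∑ j ∈ Finset.range N, c j) = 0 := by
    rw [map_sub, map_sum, Finset.sum_congr rfl hc, ← hN, ← hTw N, ho, sub_self]
  obtain ⟨m, hm, hm0⟩ := of_zero_exact (fun j => Z j) g h0
  have hm0 : T N m hm (w N - ∑ j ∈ Finset.range N, c j) = 0 := hm0
  let e : ℕ → Module.End Λ (Z m) := fun j => if hj : j ≤ m then T j m hj ∘ₗ a j ∘ₗ o m else 0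
  have hwm : w m = ∑ j ∈ Finset.range N, e j (w m) := by
    have h1 : T N m hm (w N) = w m := by rw [← hTw N, hT, hTw]
    rw [map_sub, h1, sub_eq_zero, map_sum] at hm0
    refine hm0.trans (Finset.sum_congr rfl fun j hj => ?_)
    have hj := (Finset.mem_range.1 hj).le
    simp only [c, e, dif_pos hj, dif_pos (hj.trans hm), LinearMap.comp_apply]
    rw [hT, ← hTw m, ho]
  have hnu : ∀ j ∈ Finset.range N, ¬ IsUnit (e j) := by
    intro j hj hu
    have hj := Finset.mem_range.1 hj
    have hjm : j ≤ m := hj.le.trans hm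
    simp only [e, dif_pos hjm] at hu
    have := hloc j
    have := hloc m
    obtain ⟨γ, hγ⟩ := split_of_unit (T j m hjm) (a j ∘ₗ o m) hu
    apply hg j (γ ∘ₗ T (j+1) m (by omega))
    ext x
    have := LinearMap.congr_fun hγ x
    rw [LinearMap.comp_apply, ← hT j (j+1) m (by omega) (by omega), hT1] at this
    exact this
  have := hloc m
  have hnu' := nonunit_sum _ e hnu
  refine ⟨m, ?_⟩
  set ε := ∑ j ∈ Finset.range N, e j with hε
  have hu : IsUnit (1 - ε) := by
    rcases IsLocalRing.isUnit_or_isUnit_of_add_one (a := ε) (b := 1 - ε) (by abel) with h | h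
    · exact absurd h hnu'
    · exact h
  have hz : (1 - ε) (w m) = 0 := by
    rw [LinearMap.sub_apply, Module.End.one_apply, hε, LinearMap.sum_apply, ← hwm, sub_self]
  exact ((Module.End.isUnit_iff _).1 hu).1 (hz.trans (map_zero _).symm)

/-- The maps out of `Z` not killing `w` detect only finitely many indecomposables. -/
def Good (𝔪 : Set (ModuleCat.{0} Λ)) (Z : ModuleCat.{0} Λ) (w : Z) : Prop :=
  ∃ N ∈ 𝔪, ∀ Y ∈ 𝔪, IsLocalRing (Module.End Λ Y) → ∀ f : Z →ₗ[Λ] Y, f w ≠ 0 → IsSummand Y N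

lemma isSummand_sum {ι : Type} (X : ι → ModuleCat.{0} Λ) (i : ι) :
    IsSummand (X i) (ModuleCat.of Λ (⨁ i, X i)) := by
  classical
  refine ⟨ModuleCat.ofHom (DirectSum.lof Λ ι (fun i => X i) i),
    ModuleCat.ofHom (DirectSum.component Λ ι (fun i => X i) i), ?_⟩
  ext x
  exact DirectSum.component.lof_self (M := fun i => X i) Λ i x

lemma bad_step (R : Type) [CommRing R] [IsArtinianRing R] [Algebra R Λ] [Module.Finite R Λ]
    (h : IsNClusterTilting n (modFG Λ) 𝔪) (Z : ModuleCat.{0} Λ) (hZ : Z ∈ 𝔪)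
    (hloc : IsLocalRing (Module.End Λ Z)) (w : Z) (hbad : ¬ Good 𝔪 Z w) :
    ∃ Z' ∈ 𝔪, IsLocalRing (Module.End Λ Z') ∧ ∃ g : Z →ₗ[Λ] Z',
      (∀ r : Z' →ₗ[Λ] Z, r ∘ₗ g ≠ LinearMap.id) ∧ ¬ Good 𝔪 Z' (g w) := by
  by_contra hcon
  push Not at hcon
  apply hbad
  have := CT.fg h hZ
  obtain ⟨B, hB, j, hj, hju⟩ := CT.las R h Z
  obtain ⟨ι, _, V, s, r, hV, hrs, hsum⟩ := exists_decomp R B (CT.fg h hB)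
  have hVm : ∀ i, V i ∈ 𝔪 := fun i => CT.summand h
    ⟨ModuleCat.ofHom (s i), ModuleCat.ofHom (r i), by ext x; exact LinearMap.congr_fun (hrs i) x⟩ hB
  have hgood : ∀ i, Good 𝔪 (V i) ((r i ∘ₗ j) w) := by
    intro i
    refine hcon (V i) (hVm i) (hV i) (r i ∘ₗ j) fun t ht => hj (t ∘ₗ r i) ?_
    rw [LinearMap.comp_assoc]
    exact ht
  choose N hN hNs using hgood
  let X : Option ι → ModuleCat.{0} Λ := fun o => o.elim Z N
  have hX : ∀ o, X o ∈ 𝔪 := by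
    rintro (_ | i)
    · exact hZ
    · exact hN i
  refine ⟨_, CT.sum h hX, fun Y hY hYl f hf => ?_⟩
  by_cases hsp : ∃ ρ : Y →ₗ[Λ] Z, ρ ∘ₗ f = LinearMap.id
  · obtain ⟨ρ, hρ⟩ := hsp
    obtain ⟨γ, hγ⟩ := split_of_unit ρ f (by rw [hρ]; exact isUnit_one)
    have : IsSummand Y (X none) :=
      ⟨ModuleCat.ofHom ρ, ModuleCat.ofHom γ, by ext x; exact LinearMap.congr_fun hγ x⟩
    exact this.trans (isSummand_sum X none)
  · push Not at hsp
    obtain ⟨k, hk⟩ := hju Y hY f hsp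
    obtain ⟨i, hi⟩ : ∃ i, k (s i (r i (j w))) ≠ 0 := by
      by_contra hc
      push Not at hc
      apply hf
      rw [← hk, LinearMap.comp_apply, ← hsum (j w), map_sum]
      exact Finset.sum_eq_zero fun i _ => hc i
    have : IsSummand Y (X (some i)) := hNs i Y hY hYl (k ∘ₗ s i) hi
    exact this.trans (isSummand_sum X (some i))

lemma good_of_local (R : Type) [CommRing R] [IsArtinianRing R] [Algebra R Λ] [Module.Finite R Λ]
    (h : IsNClusterTilting n (modFG Λ) 𝔪) (H : IsNClusterTilting n Set.univ (AddCl 𝔪))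
    (Z : ModuleCat.{0} Λ) (hZ : Z ∈ 𝔪)
    (hloc : IsLocalRing (Module.End Λ Z)) (w : Z) : Good 𝔪 Z w := by
  by_contra hbad
  have := noeth_of_artin (Λ := Λ) R
  let T := {t : Σ Z : ModuleCat.{0} Λ, Z // t.1 ∈ 𝔪 ∧ IsLocalRing (Module.End Λ t.1) ∧ ¬ Good 𝔪 t.1 t.2}
  have hstep : ∀ t : T, ∃ t' : T, ∃ g : t.1.1 →ₗ[Λ] t'.1.1,
      (∀ r : t'.1.1 →ₗ[Λ] t.1.1, r ∘ₗ g ≠ LinearMap.id) ∧ t'.1.2 = g t.1.2 := by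
    rintro ⟨⟨Z, w⟩, hZ, hl, hb⟩
    obtain ⟨Z', hZ', hl', g, hg, hb'⟩ := bad_step R h Z hZ hl w hb
    exact ⟨⟨⟨Z', g w⟩, hZ', hl', hb'⟩, g, hg, rfl⟩
  choose nx g hg hnx using hstep
  let q : ℕ → T := fun j => Nat.rec ⟨⟨Z, w⟩, hZ, hloc, hbad⟩ (fun _ t => nx t) j
  obtain ⟨j, hj⟩ := tnil h H (fun j => (q j).1.1) (fun j => (q j).2.1) (fun j => (q j).2.2.1)
    (fun j => g (q j)) (fun j => hg (q j)) (fun j => (q j).1.2) (fun j => hnx (q j))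
  apply (q j).2.2.2
  refine ⟨(q j).1.1, (q j).2.1, fun Y _ _ f hf => ?_⟩
  exfalso
  apply hf
  rw [hj, map_zero]

lemma forward (R : Type) [CommRing R] [IsArtinianRing R] [Algebra R Λ] [Module.Finite R Λ]
    (h : IsNClusterTilting n (modFG Λ) 𝔪) (H : IsNClusterTilting n Set.univ (AddCl 𝔪)) :
    FiniteType 𝔪 := by
  classical
  let L : ModuleCat.{0} Λ := ModuleCat.of Λ Λ
  have hL : L ∈ 𝔪 := CT.proj h (inferInstanceAs (Module.Finite Λ Λ))
    (inferInstanceAs (Module.Projective Λ Λ))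
  obtain ⟨ι, _, V, s, r, hV, hrs, hsum⟩ := exists_decomp R L (CT.fg h hL)
  have hVm : ∀ i, V i ∈ 𝔪 := fun i => CT.summand h
    ⟨ModuleCat.ofHom (s i), ModuleCat.ofHom (r i), by ext x; exact LinearMap.congr_fun (hrs i) x⟩ hL
  choose N hN hNs using fun i => good_of_local R h H (V i) (hVm i) (hV i) (r i (1 : Λ))
  let M : ModuleCat.{0} Λ := ModuleCat.of Λ (⨁ i, N i)
  have hM : M ∈ 𝔪 := CT.sum h hN
  have key : ∀ Y ∈ 𝔪, IsLocalRing (Module.End Λ Y) → IsSummand Y M := by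
    intro Y hY hl
    obtain ⟨y, hy⟩ : ∃ y : Y, y ≠ 0 := by
      by_contra hc
      push Not at hc
      exact one_ne_zero (α := Module.End Λ Y) (LinearMap.ext fun y => by
        rw [hc y, map_zero, map_zero])
    let f : L →ₗ[Λ] Y := LinearMap.toSpanSingleton Λ Y y
    have hf : f (1 : Λ) = y := one_smul Λ y
    obtain ⟨i, hi⟩ : ∃ i, f (s i (r i (1 : Λ))) ≠ 0 := by
      by_contra hc
      push Not at hc
      apply hy
      rw [← hf, ← hsum (1 : Λ), map_sum]
      exact Finset.sum_eq_zero fun i _ => hc i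
    exact (hNs i Y hY hl (f ∘ₗ s i) hi).trans (isSummand_sum N i)
  refine ⟨M, hM, Set.Subset.antisymm ?_ ?_⟩
  · intro A hA
    obtain ⟨κ, _, W, s, r, hW, hrs, hsum⟩ := exists_decomp R A (CT.fg h hA)
    have hWm : ∀ i, W i ∈ 𝔪 := fun i => CT.summand h
      ⟨ModuleCat.ofHom (s i), ModuleCat.ofHom (r i),
        by ext x; exact LinearMap.congr_fun (hrs i) x⟩ hA
    choose σ ρ hσρ using fun i => key (W i) (hWm i) (hW i)
    let e := Fintype.equivFin κ
    refine addCl_of_split (Fintype.card κ) (fun j => (σ (e.symm j)).hom ∘ₗ r (e.symm j))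
      (fun j => s (e.symm j) ∘ₗ (ρ (e.symm j)).hom) fun x => ?_
    have h1 : ∀ i, s i ((ρ i).hom ((σ i).hom (r i x))) = s i (r i x) := fun i =>
      congrArg (s i) (congrArg (fun q => q.hom (r i x)) (hσρ i))
    refine Eq.trans ?_ (hsum x)
    rw [← e.symm.sum_comp]
    exact Finset.sum_congr rfl fun j _ => h1 _
  · rintro A ⟨k, X, hX, hs⟩
    have hX' : ∀ i, X i ∈ 𝔪 := fun i => by
      rw [show X i = M from hX i]; exact hM
    exact CT.summand h hs (CT.sum h hX')

end Forward


/-!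
STATEMENT 17: An `n`-homological pair `(Λ, 𝔪)` is pure semisimple (i.e. `Add 𝔪`
is an `n`-cluster tilting subcategory of `Mod Λ`) if and only if it is of finite
type (i.e. `𝔪` has an additive generator).
-/

theorem stmt17 (R : Type) [CommRing R] [IsArtinianRing R]
    [Algebra R Λ] [Module.Finite R Λ]
    (n : ℕ) (hn : 0 < n) (𝔪 : Set (ModuleCat Λ))
    (h : IsNClusterTilting n (modFG Λ) 𝔪) :
    IsNClusterTilting n Set.univ (AddCl 𝔪) ↔ FiniteType 𝔪 := by
  exact ⟨forward R h, backward R hn h⟩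

end Paper
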